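/- arXiv:1412.7326 — 2 statements merged into one kernel-verified Lean document; each statement's English description precedes it below -/
import Mathlib

section
/- Let Ω ⊆ ℝ^n be open, Λ a weight vector, m an admissible weight associated to Λ, and π(ξ) = min_{1≤j≤n} λ_j(ξ). For any sequence of symbols a_k ∈ S_{m·π^{-k},Λ}(Ω), k = 0,1,2,…, there exists a symbol a ∈ S_{m,Λ}(Ω) such that for every integer N ≥ 1 one has a − Σ_{k<N} a_k ∈ S_{m·π^{-N},Λ}(Ω). -/
open scoped BigOperators RealInnerProductSpace
open MeasureTheory

noncomputable section

abbrev Euc (n : ℕ) := EuclideanSpace ℝ (Fin n)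

/-- The Japanese bracket `⟨ξ⟩ = (1+|ξ|²)^{1/2}`. -/
def jb {n : ℕ} (ξ : Euc n) : ℝ := Real.sqrt (1 + ‖ξ‖ ^ 2)

variable {n : ℕ} {F : Type*} [NormedAddCommGroup F] [NormedSpace ℝ F]

/-- Partial derivative in direction `j`. -/
def pd (j : Fin n) (f : Euc n → F) : Euc n → F :=
  fun ξ => fderiv ℝ f ξ (EuclideanSpace.single j 1)

/-- Iterated partial derivative `∂^α`. -/
def mpd (α : Fin n → ℕ) (f : Euc n → F) : Euc n → F :=
  (List.finRange n).foldr (fun j g => (pd j)^[α j] g) f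

/-- Partial derivative in the `x` variable of a symbol. -/
def xpd (j : Fin n) (a : Euc n → Euc n → F) : Euc n → Euc n → F :=
  fun x ξ => fderiv ℝ (fun y => a y ξ) x (EuclideanSpace.single j 1)

/-- Iterated `x`-derivative `∂_x^β` of a symbol. -/
def xmpd (β : Fin n → ℕ) (a : Euc n → Euc n → F) : Euc n → Euc n → F :=
  (List.finRange n).foldr (fun j g => (xpd j)^[β j] g) a

/-- The mixed derivative `∂_ξ^α ∂_x^β a`. -/
def smpd (α β : Fin n → ℕ) (a : Euc n → Euc n → F) : Euc n → Euc n → F :=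
  fun x ξ => mpd α (xmpd β a x) ξ

/-- `Λ = (λ_1,…,λ_n)` is a weight vector: positive continuous components satisfying
the polynomial growth (PG), (M) and slowly varying (SW) conditions. -/
def IsWeightVector (Λ : Fin n → Euc n → ℝ) : Prop :=
  (∀ j, Continuous (Λ j)) ∧ (∀ j ξ, 0 < Λ j ξ) ∧
  ∃ C c : ℝ, 0 < C ∧ 0 < c ∧
    (∀ j ξ, c * jb ξ ^ c ≤ Λ j ξ ∧ Λ j ξ ≤ C * jb ξ ^ C) ∧
    (∀ j (ξ : Euc n), c * |ξ j| ≤ Λ j ξ) ∧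
    (∀ ξ η : Euc n, ∑ k, |ξ k - η k| * (Λ k η)⁻¹ ≤ c →
      ∀ j, C⁻¹ * Λ j ξ ≤ Λ j η ∧ Λ j η ≤ C * Λ j ξ)

/-- `m` is an admissible weight associated to the weight vector `Λ`:
positive, continuous, temperate and slowly varying (SW1). -/
def IsAdmissible (Λ : Fin n → Euc n → ℝ) (m : Euc n → ℝ) : Prop :=
  Continuous m ∧ (∀ ξ, 0 < m ξ) ∧
  ∃ N C c : ℝ, 0 < N ∧ 0 < C ∧ 0 < c ∧
    (∀ ξ η : Euc n, m η ≤ C * m ξ * (1 + ‖η - ξ‖) ^ N) ∧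
    (∀ ξ η : Euc n, ∑ k, |ξ k - η k| * (Λ k η)⁻¹ ≤ c →
      C⁻¹ * m ξ ≤ m η ∧ m η ≤ C * m ξ)

/-- The symbol class `S_{m,Λ}(Ω)`. -/
def IsSymbol (Ω : Set (Euc n)) (m : Euc n → ℝ) (Λ : Fin n → Euc n → ℝ)
    (a : Euc n → Euc n → ℂ) : Prop :=
  ContDiffOn ℝ (⊤ : ℕ∞) (fun p : Euc n × Euc n => a p.1 p.2) (Ω ×ˢ Set.univ) ∧
  ∀ K : Set (Euc n), IsCompact K → K ⊆ Ω → ∀ α β : Fin n → ℕ,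
    ∃ c > 0, ∀ x ∈ K, ∀ ξ, ‖smpd α β a x ξ‖ ≤ c * m ξ * (∏ k, Λ k ξ ^ α k)⁻¹

/-- The regularizing class `S^{-∞}(Ω)`. -/
def IsSmoothing (Ω : Set (Euc n)) (a : Euc n → Euc n → ℂ) : Prop :=
  ContDiffOn ℝ (⊤ : ℕ∞) (fun p : Euc n × Euc n => a p.1 p.2) (Ω ×ˢ Set.univ) ∧
  ∀ K : Set (Euc n), IsCompact K → K ⊆ Ω → ∀ (μ : ℝ) (α β : Fin n → ℕ),
    ∃ c > 0, ∀ x ∈ K, ∀ ξ, ‖smpd α β a x ξ‖ ≤ c * jb ξ ^ (μ - ∑ k, (α k : ℝ))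

/-- The `Λ`-neighborhood `X_{εΛ}` of a set `X ⊆ ℝ^n`. -/
def lamNbhd (Λ : Fin n → Euc n → ℝ) (ε : ℝ) (X : Set (Euc n)) : Set (Euc n) :=
  ⋃ ξ0 ∈ X, {ξ : Euc n | ∀ j, |ξ j - ξ0 j| < ε * Λ j ξ0}


/-! ### Words of derivatives -/

/-- A single derivative: `inl j` is in `ξ_j`, `inr j` is in `x_j`. -/
def DD (i : Fin n ⊕ Fin n) (f : Euc n → Euc n → ℂ) : Euc n → Euc n → ℂ :=
  Sum.elim (fun j => fun x => pd j (f x)) (fun j => xpd j f) i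

/-- A word of derivatives. -/
def DW (l : List (Fin n ⊕ Fin n)) (f : Euc n → Euc n → ℂ) : Euc n → Euc n → ℂ :=
  l.foldr DD f

/-- Uncurrying. -/
def UU (f : Euc n → Euc n → ℂ) : Euc n × Euc n → ℂ := fun p => f p.1 p.2

/-- The direction of a derivative. -/
def dirv (i : Fin n ⊕ Fin n) : Euc n × Euc n :=
  Sum.elim (fun j => (0, EuclideanSpace.single j 1)) (fun j => (EuclideanSpace.single j 1, 0)) i

/-- A word of `ξ`-derivatives of a real function. -/
def pdw (s : List (Fin n)) (b : Euc n → ℝ) : Euc n → ℝ := s.foldr pd b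

lemma DW_cons (i : Fin n ⊕ Fin n) (l : List (Fin n ⊕ Fin n)) (f : Euc n → Euc n → ℂ) :
    DW (i :: l) f = DD i (DW l f) := rfl

lemma DW_append (l l' : List (Fin n ⊕ Fin n)) (f : Euc n → Euc n → ℂ) :
    DW (l ++ l') f = DW l (DW l' f) := by
  simp [DW, List.foldr_append]

lemma DD_eq {O : Set (Euc n × Euc n)} (hO : IsOpen O) {f : Euc n → Euc n → ℂ}
    (hf : ContDiffOn ℝ (⊤ : ℕ∞) (UU f) O) (i : Fin n ⊕ Fin n) {p : Euc n × Euc n} (hp : p ∈ O) :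
    DD i f p.1 p.2 = fderiv ℝ (UU f) p (dirv i) := by
  have hd : DifferentiableAt ℝ (UU f) p :=
    (hf.contDiffAt (hO.mem_nhds hp)).differentiableAt (by simp)
  obtain ⟨x, ξ⟩ := p
  rcases i with j | j
  · have h1 : HasFDerivAt (fun η : Euc n => (x, η)) (ContinuousLinearMap.inr ℝ (Euc n) (Euc n)) ξ :=
      hasFDerivAt_prodMk_right x ξ
    have h2 := HasFDerivAt.comp (g := UU f) ξ hd.hasFDerivAt h1
    have h3 : f x = UU f ∘ fun η : Euc n => (x, η) := rfl
    simp only [DD, Sum.elim_inl, pd, dirv]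
    rw [h3, h2.fderiv]
    simp
  · have h1 : HasFDerivAt (fun y : Euc n => (y, ξ)) (ContinuousLinearMap.inl ℝ (Euc n) (Euc n)) x :=
      hasFDerivAt_prodMk_left x ξ
    have h2 := HasFDerivAt.comp (g := UU f) x hd.hasFDerivAt h1
    have h3 : (fun y => f y ξ) = UU f ∘ fun y : Euc n => (y, ξ) := rfl
    simp only [DD, Sum.elim_inr, xpd, dirv]
    rw [h3, h2.fderiv]
    simp

lemma DD_smooth {O : Set (Euc n × Euc n)} (hO : IsOpen O) {f : Euc n → Euc n → ℂ}
    (hf : ContDiffOn ℝ (⊤ : ℕ∞) (UU f) O) (i : Fin n ⊕ Fin n) :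
    ContDiffOn ℝ (⊤ : ℕ∞) (UU (DD i f)) O := by
  have h := hf.fderiv_of_isOpen hO (m := ((⊤ : ℕ∞) : WithTop ℕ∞)) (by simp)
  have h2 : ContDiffOn ℝ (⊤ : ℕ∞) (fun p => fderiv ℝ (UU f) p (dirv i)) O :=
    h.clm_apply contDiffOn_const
  exact h2.congr fun p hp => DD_eq hO hf i hp

lemma DW_smooth {O : Set (Euc n × Euc n)} (hO : IsOpen O) {f : Euc n → Euc n → ℂ}
    (hf : ContDiffOn ℝ (⊤ : ℕ∞) (UU f) O) (l : List (Fin n ⊕ Fin n)) :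
    ContDiffOn ℝ (⊤ : ℕ∞) (UU (DW l f)) O := by
  induction l with
  | nil => exact hf
  | cons i l ih => exact DD_smooth hO ih i

lemma DD_congr {O : Set (Euc n × Euc n)} (hO : IsOpen O) {f g : Euc n → Euc n → ℂ}
    (h : ∀ p ∈ O, f p.1 p.2 = g p.1 p.2) (i : Fin n ⊕ Fin n) :
    ∀ p ∈ O, DD i f p.1 p.2 = DD i g p.1 p.2 := by
  rintro ⟨x, ξ⟩ hp
  have hn : O ∈ nhds (x, ξ) := hO.mem_nhds hp
  rcases i with j | j
  · have : f x =ᶠ[nhds ξ] g x := by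
      have hc : Continuous fun η : Euc n => (x, η) := by fun_prop
      filter_upwards [hc.continuousAt.preimage_mem_nhds hn] with η hη
      exact h (x, η) hη
    simp only [DD, Sum.elim_inl, pd]
    rw [this.fderiv_eq]
  · have : (fun y => f y ξ) =ᶠ[nhds x] (fun y => g y ξ) := by
      have hc : Continuous fun y : Euc n => (y, ξ) := by fun_prop
      filter_upwards [hc.continuousAt.preimage_mem_nhds hn] with η hη
      exact h (η, ξ) hη
    simp only [DD, Sum.elim_inr, xpd]
    rw [this.fderiv_eq]

lemma DW_congr {O : Set (Euc n × Euc n)} (hO : IsOpen O) {f g : Euc n → Euc n → ℂ}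
    (h : ∀ p ∈ O, f p.1 p.2 = g p.1 p.2) (l : List (Fin n ⊕ Fin n)) :
    ∀ p ∈ O, DW l f p.1 p.2 = DW l g p.1 p.2 := by
  induction l with
  | nil => exact h
  | cons i l ih => exact DD_congr hO ih i

lemma DW_zero (l : List (Fin n ⊕ Fin n)) : DW l (fun _ _ => 0) = fun _ _ => 0 := by
  induction l with
  | nil => rfl
  | cons i l ih =>
    rw [DW_cons, ih]
    funext x ξ
    rcases i with j | j <;> simp [DD, pd, xpd]

lemma DW_sub {O : Set (Euc n × Euc n)} (hO : IsOpen O) {f g : Euc n → Euc n → ℂ}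
    (hf : ContDiffOn ℝ (⊤ : ℕ∞) (UU f) O) (hg : ContDiffOn ℝ (⊤ : ℕ∞) (UU g) O)
    (l : List (Fin n ⊕ Fin n)) :
    ∀ p ∈ O, DW l (fun x ξ => f x ξ - g x ξ) p.1 p.2 = DW l f p.1 p.2 - DW l g p.1 p.2 := by
  induction l with
  | nil => intro p _; rfl
  | cons i l ih =>
    intro p hp
    have h1 := DW_smooth hO hf l
    have h2 := DW_smooth hO hg l
    rw [DW_cons, DW_cons, DW_cons,
      DD_congr hO (g := fun x ξ => DW l f x ξ - DW l g x ξ) ih i p hp, DD_eq hO h1 i hp,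
      DD_eq hO h2 i hp,
      DD_eq hO (f := fun x ξ => DW l f x ξ - DW l g x ξ) (h1.sub h2) i hp]
    have d1 := (h1.contDiffAt (hO.mem_nhds hp)).differentiableAt (by simp)
    have d2 := (h2.contDiffAt (hO.mem_nhds hp)).differentiableAt (by simp)
    have := fderiv_sub d1 d2
    change (fderiv ℝ (UU (DW l f) - UU (DW l g)) p) _ = _
    rw [this]; rfl

lemma DW_sum {O : Set (Euc n × Euc n)} (hO : IsOpen O) {f : ℕ → Euc n → Euc n → ℂ}
    (hf : ∀ k, ContDiffOn ℝ (⊤ : ℕ∞) (UU (f k)) O) (S : Finset ℕ)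
    (l : List (Fin n ⊕ Fin n)) :
    ∀ p ∈ O, DW l (fun x ξ => ∑ k ∈ S, f k x ξ) p.1 p.2 = ∑ k ∈ S, DW l (f k) p.1 p.2 := by
  induction l with
  | nil => intro p _; rfl
  | cons i l ih =>
    intro p hp
    have h1 := fun k => DW_smooth hO (hf k) l
    have hs : ContDiffOn ℝ (⊤ : ℕ∞) (UU (fun x ξ => ∑ k ∈ S, DW l (f k) x ξ)) O :=
      ContDiffOn.sum (f := fun k => UU (DW l (f k))) fun k _ => h1 k
    rw [DW_cons,
      DD_congr hO (g := fun x ξ => ∑ k ∈ S, DW l (f k) x ξ) ih i p hp, DD_eq hO hs i hp]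
    have d1 := fun k => ((h1 k).contDiffAt (hO.mem_nhds hp)).differentiableAt (by simp)
    have := fderiv_fun_sum (u := S) (A := fun k => UU (DW l (f k))) fun k _ => d1 k
    change (fderiv ℝ (fun p => ∑ k ∈ S, UU (DW l (f k)) p) p) _ = _
    rw [this, sum_apply]
    exact Finset.sum_congr rfl fun k _ => (DD_eq hO (h1 k) i hp).symm

lemma pdw_smooth {b : Euc n → ℝ} (hb : ContDiff ℝ (⊤ : ℕ∞) b) (s : List (Fin n)) :
    ContDiff ℝ (⊤ : ℕ∞) (pdw s b) := by
  induction s with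
  | nil => exact hb
  | cons j s ih =>
    have h := ih.fderiv_right (m := ((⊤ : ℕ∞) : WithTop ℕ∞)) (by simp)
    exact h.clm_apply contDiff_const

lemma smul_smooth {O : Set (Euc n × Euc n)} {b : Euc n → ℝ} (hb : ContDiff ℝ (⊤ : ℕ∞) b)
    {f : Euc n → Euc n → ℂ} (hf : ContDiffOn ℝ (⊤ : ℕ∞) (UU f) O) :
    ContDiffOn ℝ (⊤ : ℕ∞) (UU (fun x ξ => b ξ • f x ξ)) O :=
  (hb.comp contDiff_snd).contDiffOn.smul hf

lemma DD_smul {O : Set (Euc n × Euc n)} (hO : IsOpen O) {b : Euc n → ℝ}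
    (hb : ContDiff ℝ (⊤ : ℕ∞) b)
    {f : Euc n → Euc n → ℂ} (hf : ContDiffOn ℝ (⊤ : ℕ∞) (UU f) O) (i : Fin n ⊕ Fin n)
    {p : Euc n × Euc n} (hp : p ∈ O) :
    DD i (fun x ξ => b ξ • f x ξ) p.1 p.2 =
      (Sum.elim (fun j => pd j b p.2 • f p.1 p.2) (fun _ => (0 : ℂ)) i) +
        b p.2 • DD i f p.1 p.2 := by
  rw [DD_eq hO (smul_smooth hb hf) i hp, DD_eq hO hf i hp]
  have d1 := (hf.contDiffAt (hO.mem_nhds hp)).differentiableAt (by simp)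
  have d2 : HasFDerivAt b (fderiv ℝ b p.2) p.2 :=
    (hb.contDiffAt.differentiableAt (by simp)).hasFDerivAt
  have d3 := HasFDerivAt.comp (g := b) p d2 (hasFDerivAt_snd (𝕜 := ℝ) (E := Euc n) (F := Euc n))
  have d4 := d3.smul d1.hasFDerivAt
  have : fderiv ℝ (UU fun x ξ => b ξ • f x ξ) p = _ := d4.fderiv
  rw [this]
  rcases i with j | j
  · simp [dirv, pd, UU, add_comm]
  · simp [dirv]

lemma leibniz (l : List (Fin n ⊕ Fin n)) :
    ∃ T : List (List (Fin n) × List (Fin n ⊕ Fin n)), (∀ t ∈ T, t.2.Sublist l) ∧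
      ∀ (O : Set (Euc n × Euc n)), IsOpen O → ∀ b : Euc n → ℝ, ContDiff ℝ (⊤ : ℕ∞) b →
      ∀ f : Euc n → Euc n → ℂ, ContDiffOn ℝ (⊤ : ℕ∞) (UU f) O → ∀ p ∈ O,
        DW l (fun x ξ => b ξ • f x ξ) p.1 p.2 =
          (T.map fun t => pdw t.1 b p.2 • DW t.2 f p.1 p.2).sum := by
  induction l with
  | nil => exact ⟨[([], [])], by simp, fun O _ b _ f _ p _ => by simp [DW, pdw]⟩
  | cons i l ih =>
    obtain ⟨T, hT, h⟩ := ih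
    have key : ∀ T : List (List (Fin n) × List (Fin n ⊕ Fin n)),
      ∀ (O : Set (Euc n × Euc n)), IsOpen O → ∀ b : Euc n → ℝ, ContDiff ℝ (⊤ : ℕ∞) b →
      ∀ f : Euc n → Euc n → ℂ, ContDiffOn ℝ (⊤ : ℕ∞) (UU f) O →
        ContDiffOn ℝ (⊤ : ℕ∞)
          (UU fun x ξ => (T.map fun t => pdw t.1 b ξ • DW t.2 f x ξ).sum) O ∧ ∀ p ∈ O,
        DD i (fun x ξ => (T.map fun t => pdw t.1 b ξ • DW t.2 f x ξ).sum) p.1 p.2 =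
          (T.map fun t => DD i (fun x ξ => pdw t.1 b ξ • DW t.2 f x ξ) p.1 p.2).sum := by
      intro T O hO b hb f hf
      induction T with
      | nil =>
        refine ⟨contDiffOn_const, fun p hp => ?_⟩
        simp only [List.map_nil, List.sum_nil]
        exact congrFun (congrFun (DW_zero [i]) p.1) p.2
      | cons t T ih =>
        have hs := smul_smooth (pdw_smooth hb t.1) (DW_smooth hO hf t.2)
        have hS : ContDiffOn ℝ (⊤ : ℕ∞)
          (UU fun x ξ => ((t :: T).map fun t => pdw t.1 b ξ • DW t.2 f x ξ).sum) O := by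
          simp only [List.map_cons, List.sum_cons]
          exact hs.add ih.1
        refine ⟨hS, fun p hp => ?_⟩
        rw [DD_eq hO hS i hp]
        simp only [List.map_cons, List.sum_cons]
        rw [← ih.2 p hp, DD_eq hO ih.1 i hp, DD_eq hO hs i hp]
        have d1 := (hs.contDiffAt (hO.mem_nhds hp)).differentiableAt (by simp)
        have d2 := (ih.1.contDiffAt (hO.mem_nhds hp)).differentiableAt (by simp)
        have h5 := congrArg (fun L => L (dirv i)) (fderiv_add d1 d2)
        exact h5
    have hmain : ∀ (O : Set (Euc n × Euc n)), IsOpen O → ∀ b : Euc n → ℝ,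
      ContDiff ℝ (⊤ : ℕ∞) b →
      ∀ f : Euc n → Euc n → ℂ, ContDiffOn ℝ (⊤ : ℕ∞) (UU f) O → ∀ p ∈ O,
        DW (i :: l) (fun x ξ => b ξ • f x ξ) p.1 p.2 =
          (T.map fun t => (Sum.elim (fun j => pdw (j :: t.1) b p.2 • DW t.2 f p.1 p.2)
            (fun _ => (0 : ℂ)) i) + pdw t.1 b p.2 • DW (i :: t.2) f p.1 p.2).sum := by
      intro O hO b hb f hf p hp
      rw [DW_cons, DD_congr hO
        (g := fun x ξ => (T.map fun t => pdw t.1 b ξ • DW t.2 f x ξ).sum)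
        (h O hO b hb f hf) i p hp, (key T O hO b hb f hf).2 p hp]
      congr 1
      apply List.map_congr_left
      intro t _
      exact DD_smul hO (pdw_smooth hb t.1) (DW_smooth hO hf t.2) i hp
    rcases i with j | j
    · refine ⟨T.map (fun t => (j :: t.1, t.2)) ++ T.map (fun t => (t.1, Sum.inl j :: t.2)), ?_, ?_⟩
      · intro t ht
        simp only [List.mem_append, List.mem_map] at ht
        rcases ht with ⟨u, hu, rfl⟩ | ⟨u, hu, rfl⟩
        · exact (hT u hu).cons _
        · exact (hT u hu).cons_cons _
      · intro O hO b hb f hf p hp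
        rw [hmain O hO b hb f hf p hp]
        simp only [Sum.elim_inl, List.sum_map_add, List.map_append, List.sum_append, List.map_map]
        rfl
    · refine ⟨T.map (fun t => (t.1, Sum.inr j :: t.2)), ?_, ?_⟩
      · intro t ht
        simp only [List.mem_map] at ht
        rcases ht with ⟨u, hu, rfl⟩
        exact (hT u hu).cons_cons _
      · intro O hO b hb f hf p hp
        rw [hmain O hO b hb f hf p hp]
        simp only [Sum.elim_inr, zero_add, List.map_map]
        rfl

/-- Canonical words. -/
def canw (α β : Fin n → ℕ) : List (Fin n ⊕ Fin n) :=
  ((List.finRange n).flatMap fun j => List.replicate (α j) (Sum.inl j)) ++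
  ((List.finRange n).flatMap fun j => List.replicate (β j) (Sum.inr j))

lemma DW_replicate (i : Fin n ⊕ Fin n) (k : ℕ) (f : Euc n → Euc n → ℂ) :
    DW (List.replicate k i) f = (DD i)^[k] f := by
  induction k with
  | zero => rfl
  | succ k ih => rw [List.replicate_succ, DW_cons, ih, Function.iterate_succ_apply']

lemma DW_canw (α β : Fin n → ℕ) (f : Euc n → Euc n → ℂ) :
    DW (canw α β) f = smpd α β f := by
  have h1 : ∀ L : List (Fin n), DW (L.flatMap fun j => List.replicate (β j) (Sum.inr j)) f =
      L.foldr (fun j g => (xpd j)^[β j] g) f := by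
    intro L
    induction L with
    | nil => rfl
    | cons j L ih =>
      rw [List.flatMap_cons, DW_append, ih, DW_replicate]; rfl
  have h3 : ∀ (j : Fin n) (k : ℕ) (g : Euc n → Euc n → ℂ) (x : Euc n),
      (DD (Sum.inl j))^[k] g x = (pd j)^[k] (g x) := by
    intro j k g x
    induction k with
    | zero => rfl
    | succ k ih => rw [Function.iterate_succ_apply', Function.iterate_succ_apply', ← ih]; rfl
  have h2 : ∀ (L : List (Fin n)) (g : Euc n → Euc n → ℂ) (x : Euc n),
      DW (L.flatMap fun j => List.replicate (α j) (Sum.inl j)) g x =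
      L.foldr (fun j g => (pd j)^[α j] g) (g x) := by
    intro L g x
    induction L with
    | nil => rfl
    | cons j L ih =>
      rw [List.flatMap_cons, DW_append, DW_replicate, h3, ih]; rfl
  funext x ξ
  rw [canw, DW_append, h2, h1]; rfl

lemma sublist_flat {ι τ : Type*} [DecidableEq ι] (e : ι → τ) (α : ι → ℕ) (L : List ι)
    (hL : L.Nodup) : ∀ s : List τ, s.Sublist (L.flatMap fun j => List.replicate (α j) (e j)) →
      ∃ α' : ι → ℕ, s = L.flatMap fun j => List.replicate (α' j) (e j) := by
  induction L with
  | nil => intro s hs; exact ⟨α, by simpa using hs⟩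
  | cons j L ih =>
    intro s hs
    rw [List.flatMap_cons, List.sublist_append_iff] at hs
    obtain ⟨s1, s2, rfl, h1, h2⟩ := hs
    obtain ⟨k, -, rfl⟩ := List.sublist_replicate_iff.1 h1
    obtain ⟨α', rfl⟩ := ih hL.of_cons s2 h2
    refine ⟨Function.update α' j k, ?_⟩
    rw [List.flatMap_cons, Function.update_self]
    congr 1
    apply List.flatMap_congr
    intro i hi
    have : i ≠ j := fun h => (List.nodup_cons.1 hL).1 (h ▸ hi)
    rw [Function.update_of_ne this]

lemma sublist_canw (α β : Fin n → ℕ) (s : List (Fin n ⊕ Fin n)) (hs : s.Sublist (canw α β)) :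
    ∃ α' β', s = canw α' β' := by
  rw [canw, List.sublist_append_iff] at hs
  obtain ⟨s1, s2, rfl, h1, h2⟩ := hs
  obtain ⟨α', rfl⟩ := sublist_flat _ _ _ (List.nodup_finRange n) _ h1
  obtain ⟨β', rfl⟩ := sublist_flat _ _ _ (List.nodup_finRange n) _ h2
  exact ⟨α', β', rfl⟩

/-! ### The cutoff -/

/-- The basic bump function: `1` on the unit ball, `0` outside the ball of radius two. -/
def bmp : ContDiffBump (0 : Euc n) := ⟨1, 2, one_pos, one_lt_two⟩

/-- The rescaled bump. -/
def cut (R : ℝ) : Euc n → ℝ := fun ξ => (bmp : ContDiffBump (0 : Euc n)) (R⁻¹ • ξ)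

lemma cut_smooth (R : ℝ) : ContDiff ℝ (⊤ : ℕ∞) (cut R : Euc n → ℝ) :=
  (bmp : ContDiffBump (0 : Euc n)).contDiff.comp (contDiff_const_smul R⁻¹)

lemma cut_one {R : ℝ} (hR : 1 ≤ R) {ξ : Euc n} (h : ‖ξ‖ ≤ R) : cut R ξ = 1 := by
  apply ContDiffBump.one_of_mem_closedBall
  have : (bmp : ContDiffBump (0 : Euc n)).rIn = 1 := rfl
  rw [this, mem_closedBall_zero_iff, norm_smul, norm_inv, Real.norm_eq_abs,
    abs_of_pos (by linarith), inv_mul_le_iff₀ (by linarith)]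
  linarith

lemma cut_zero {R : ℝ} (hR : 1 ≤ R) {ξ : Euc n} (h : 2 * R ≤ ‖ξ‖) : cut R ξ = 0 := by
  apply ContDiffBump.zero_of_le_dist
  have : (bmp : ContDiffBump (0 : Euc n)).rOut = 2 := rfl
  rw [this, dist_zero_right, norm_smul, norm_inv, Real.norm_eq_abs,
    abs_of_pos (by linarith), le_inv_mul_iff₀ (by linarith)]
  linarith

lemma pdw_bmp_bdd (s : List (Fin n)) :
    ∃ B, ∀ ξ, ‖pdw s (bmp : ContDiffBump (0 : Euc n)) ξ‖ ≤ B := by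
  have hs : HasCompactSupport (pdw s (bmp : ContDiffBump (0 : Euc n))) := by
    induction s with
    | nil => exact ContDiffBump.hasCompactSupport _
    | cons j s ih => exact ih.fderiv_apply ℝ _
  exact (pdw_smooth (ContDiffBump.contDiff _) s).continuous.bounded_above_of_compact_support hs

lemma pdw_cut (R : ℝ) (s : List (Fin n)) :
    pdw s (cut R : Euc n → ℝ) = fun ξ => (R⁻¹) ^ s.length *
      pdw s (bmp : ContDiffBump (0 : Euc n)) (R⁻¹ • ξ) := by
  induction s with
  | nil => funext ξ; simp [pdw, cut]
  | cons j s ih =>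
    have : pdw (j :: s) (cut R : Euc n → ℝ) = pd j (pdw s (cut R)) := rfl
    rw [this, ih]
    funext ξ
    have h : (fun ξ : Euc n => (R⁻¹) ^ s.length *
      pdw s (bmp : ContDiffBump (0 : Euc n)) (R⁻¹ • ξ)) = fun ξ => (R⁻¹) ^ s.length •
        (fun ξ : Euc n => pdw s (bmp : ContDiffBump (0 : Euc n)) (R⁻¹ • ξ)) ξ := rfl
    have h2 : pdw (j :: s) (bmp : ContDiffBump (0 : Euc n)) = pd j (pdw s bmp) := rfl
    rw [h, h2]
    simp only [pd]
    have hd : DifferentiableAt ℝ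
        (fun ξ : Euc n => pdw s (bmp : ContDiffBump (0 : Euc n)) (R⁻¹ • ξ)) ξ :=
      (((pdw_smooth (ContDiffBump.contDiff _) s).comp
        (contDiff_const_smul R⁻¹)).differentiable (by simp)) ξ
    rw [fderiv_fun_const_smul hd, fderiv_comp_smul]
    simp [pow_succ, mul_assoc]

lemma pdw_cut_bdd (s : List (Fin n)) :
    ∃ B, 0 ≤ B ∧ ∀ R : ℝ, 1 ≤ R → ∀ ξ : Euc n, ‖pdw s (cut R) ξ‖ ≤ B := by
  obtain ⟨B, hB⟩ := pdw_bmp_bdd s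
  have hB0 : 0 ≤ B := (norm_nonneg _).trans (hB 0)
  refine ⟨B, hB0, fun R hR ξ => ?_⟩
  rw [pdw_cut, norm_mul, norm_pow, norm_inv, Real.norm_eq_abs, abs_of_pos (by linarith)]
  calc _ ≤ 1 * B := by
        gcongr
        · exact pow_le_one₀ (by positivity) (inv_le_one_of_one_le₀ hR)
        · exact hB _
    _ = B := one_mul B

lemma isOpen_dom {Ω : Set (Euc n)} (hΩ : IsOpen Ω) : IsOpen (Ω ×ˢ (Set.univ : Set (Euc n))) :=
  hΩ.prod isOpen_univ

lemma one_le_jb (ξ : Euc n) : 1 ≤ jb ξ := by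
  rw [jb, Real.one_le_sqrt]; nlinarith [sq_nonneg ‖ξ‖]

lemma norm_le_jb (ξ : Euc n) : ‖ξ‖ ≤ jb ξ := by
  rw [jb]; apply Real.le_sqrt_of_sq_le; linarith

/-- Crude isotropic bound on the derivatives of a cut-off symbol, uniform in the cutoff radius. -/
lemma crude {Ω : Set (Euc n)} (hΩ : IsOpen Ω) {w : Euc n → ℝ} (hw : ∀ ξ, 0 < w ξ)
    {Λ : Fin n → Euc n → ℝ} {c0 : ℝ} (hc0 : 0 < c0) (hΛ : ∀ j ξ, c0 ≤ Λ j ξ)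
    {f : Euc n → Euc n → ℂ} (hf : IsSymbol Ω w Λ f) {K : Set (Euc n)} (hK : IsCompact K)
    (hKΩ : K ⊆ Ω) (α β : Fin n → ℕ) :
    ∃ C, 0 ≤ C ∧ ∀ R : ℝ, 1 ≤ R → ∀ x ∈ K, ∀ ξ,
      ‖DW (canw α β) (fun x ξ => cut R ξ • f x ξ) x ξ‖ ≤ C * w ξ ∧
      ‖DW (canw α β) f x ξ‖ ≤ C * w ξ := by
  have base : ∀ α β : Fin n → ℕ, ∃ C, 0 ≤ C ∧ ∀ x ∈ K, ∀ ξ,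
      ‖DW (canw α β) f x ξ‖ ≤ C * w ξ := by
    intro α β
    obtain ⟨c, hc, h⟩ := hf.2 K hK hKΩ α β
    have hp : 0 < ∏ k, c0 ^ α k := Finset.prod_pos fun k _ => pow_pos hc0 _
    refine ⟨c * (∏ k, c0 ^ α k)⁻¹, by positivity, fun x hx ξ => ?_⟩
    rw [DW_canw]
    refine (h x hx ξ).trans ?_
    have : (∏ k, Λ k ξ ^ α k)⁻¹ ≤ (∏ k, c0 ^ α k)⁻¹ := by
      apply inv_anti₀ hp
      apply Finset.prod_le_prod
      · intro k _; positivity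
      · intro k _; exact pow_le_pow_left₀ hc0.le (hΛ k ξ) _
    have hwξ := hw ξ
    calc c * w ξ * (∏ k, Λ k ξ ^ α k)⁻¹ ≤ c * w ξ * (∏ k, c0 ^ α k)⁻¹ := by gcongr
      _ = _ := by ring
  obtain ⟨C0, hC0, hb0⟩ := base α β
  obtain ⟨T, hT, hleib⟩ := leibniz (canw α β)
  have key : ∀ T : List (List (Fin n) × List (Fin n ⊕ Fin n)),
      (∀ t ∈ T, t.2.Sublist (canw α β)) → ∃ C, 0 ≤ C ∧ ∀ R : ℝ, 1 ≤ R → ∀ x ∈ K, ∀ ξ,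
        ‖(T.map fun t => pdw t.1 (cut R) ξ • DW t.2 f x ξ).sum‖ ≤ C * w ξ := by
    intro T
    induction T with
    | nil => exact fun _ => ⟨0, le_rfl, fun R _ x _ ξ => by simp⟩
    | cons t T ih =>
      intro hT
      obtain ⟨C, hC, h⟩ := ih fun u hu => hT u (List.mem_cons_of_mem _ hu)
      obtain ⟨α', β', he⟩ := sublist_canw α β t.2 (hT t List.mem_cons_self)
      obtain ⟨C1, hC1, h1⟩ := base α' β'
      obtain ⟨B, hB, h2⟩ := pdw_cut_bdd t.1
      refine ⟨B * C1 + C, by positivity, fun R hR x hx ξ => ?_⟩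
      rw [List.map_cons, List.sum_cons, he]
      refine (norm_add_le _ _).trans ?_
      rw [add_mul]
      refine add_le_add ?_ (h R hR x hx ξ)
      rw [norm_smul, mul_assoc]
      exact mul_le_mul (h2 R hR ξ) (h1 x hx ξ) (norm_nonneg _) hB
  obtain ⟨C, hC, h⟩ := key T hT
  refine ⟨C + C0, by positivity, fun R hR x hx ξ => ?_⟩
  have hwξ := hw ξ
  constructor
  · rw [hleib _ (isOpen_dom hΩ) (cut R) (cut_smooth R) f hf.1 (x, ξ) ⟨hKΩ hx, trivial⟩]
    refine (h R hR x hx ξ).trans ?_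
    nlinarith
  · refine (hb0 x hx ξ).trans ?_
    nlinarith

/-- Bounds on a compactly supported piece. -/
lemma compactPiece {Ω : Set (Euc n)} (hΩ : IsOpen Ω) {g : Euc n → ℝ} (hg : ∀ ξ, 0 < g ξ)
    (hgc : Continuous g) {f : Euc n → Euc n → ℂ}
    (hf : ContDiffOn ℝ (⊤ : ℕ∞) (UU f) (Ω ×ˢ Set.univ)) {K : Set (Euc n)} (hK : IsCompact K)
    (hKΩ : K ⊆ Ω) (l : List (Fin n ⊕ Fin n)) {R : ℝ} (hR : 1 ≤ R) :
    ∃ C, 0 ≤ C ∧ ∀ x ∈ K, ∀ ξ, ‖DW l (fun x ξ => cut R ξ • f x ξ) x ξ‖ ≤ C * g ξ := by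
  have hs := DW_smooth (isOpen_dom hΩ) (smul_smooth (cut_smooth R) hf) l
  have hcpt : IsCompact (K ×ˢ Metric.closedBall (0 : Euc n) (2 * R)) :=
    hK.prod (isCompact_closedBall _ _)
  have hcont : ContinuousOn (fun p : Euc n × Euc n =>
      (g p.2)⁻¹ • UU (DW l (fun x ξ => cut R ξ • f x ξ)) p)
      (K ×ˢ Metric.closedBall (0 : Euc n) (2 * R)) := by
    apply ContinuousOn.fun_smul
    · exact ((hgc.comp continuous_snd).inv₀ fun p => (hg _).ne').continuousOn
    · exact hs.continuousOn.mono (Set.prod_mono hKΩ (Set.subset_univ _))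
  obtain ⟨C, hC⟩ := hcpt.exists_bound_of_continuousOn hcont
  refine ⟨max C 0, le_max_right _ _, fun x hx ξ => ?_⟩
  have hgξ := hg ξ
  by_cases h : ‖ξ‖ ≤ 2 * R
  · have := hC (x, ξ) ⟨hx, by simpa using h⟩
    rw [norm_smul, norm_inv, Real.norm_eq_abs, abs_of_pos hgξ, inv_mul_le_iff₀ hgξ] at this
    refine (show _ ≤ g ξ * C from this).trans ?_
    rw [mul_comm]
    gcongr
    exact le_max_left _ _
  · push Not at h
    have hopen : IsOpen {p : Euc n × Euc n | 2 * R < ‖p.2‖} :=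
      isOpen_lt continuous_const (continuous_snd.norm)
    have := DW_congr hopen (f := fun x ξ => cut R ξ • f x ξ) (g := fun _ _ => 0)
      (fun p hp => by
        show cut R p.2 • f p.1 p.2 = 0
        rw [cut_zero hR (le_of_lt hp), zero_smul]) l (x, ξ) h
    rw [DW_zero] at this
    change DW l (fun x ξ => cut R ξ • f x ξ) x ξ = 0 at this
    rw [this, norm_zero]
    positivity

/-- The loss of powers of `⟨ξ⟩` is compensated by powers of `π`. -/
lemma weightBound (hn : 0 < n) {Λ : Fin n → Euc n → ℝ} {C c : ℝ} (hC : 0 < C) (hc : 0 < c)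
    (hpg : ∀ j ξ, c * jb ξ ^ c ≤ Λ j ξ ∧ Λ j ξ ≤ C * jb ξ ^ C) (k N : ℕ) (α : Fin n → ℕ)
    (hNk : N ≤ k) (h : C * (∑ j, α j : ℕ) + 1 ≤ c * ((k : ℝ) - N)) :
    ∃ B, 0 ≤ B ∧ ∀ ξ, ((⨅ j, Λ j ξ) ^ k)⁻¹ ≤
      B * (jb ξ)⁻¹ * (((⨅ j, Λ j ξ) ^ N)⁻¹ * (∏ j, Λ j ξ ^ α j)⁻¹) := by
  have : Nonempty (Fin n) := ⟨⟨0, hn⟩⟩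
  refine ⟨C ^ (∑ j, α j) * (c ^ (k - N))⁻¹, by positivity, fun ξ => ?_⟩
  set P := ⨅ j, Λ j ξ with hP
  have hj1 := one_le_jb ξ
  have hj : 0 < jb ξ := by linarith
  have hPl : c * jb ξ ^ c ≤ P := le_ciInf fun j => (hpg j ξ).1
  have hP0 : 0 < P := lt_of_lt_of_le (by positivity) hPl
  have hΛ0 : ∀ j, 0 < Λ j ξ := fun j => lt_of_lt_of_le (by positivity) (hpg j ξ).1
  have h1 : ∏ j, Λ j ξ ^ α j ≤ C ^ (∑ j, α j) * jb ξ ^ (C * (∑ j, α j : ℕ)) := by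
    calc ∏ j, Λ j ξ ^ α j ≤ ∏ j, (C * jb ξ ^ C) ^ α j :=
          Finset.prod_le_prod (fun j _ => (pow_pos (hΛ0 j) _).le)
            fun j _ => pow_le_pow_left₀ (hΛ0 j).le (hpg j ξ).2 _
      _ = _ := by
          rw [Finset.prod_pow_eq_pow_sum, mul_pow, Real.rpow_mul hj.le, Real.rpow_natCast]
  have h2 : c ^ (k - N) * jb ξ ^ (C * (∑ j, α j : ℕ) + 1) ≤ P ^ (k - N) := by
    calc c ^ (k - N) * jb ξ ^ (C * (∑ j, α j : ℕ) + 1)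
        ≤ c ^ (k - N) * jb ξ ^ (c * ((k : ℝ) - N)) := by
          gcongr
      _ = (c * jb ξ ^ c) ^ (k - N) := by
          rw [mul_pow, Real.rpow_mul hj.le, ← Nat.cast_sub hNk, Real.rpow_natCast]
      _ ≤ _ := pow_le_pow_left₀ (by positivity) hPl _
  have hpp : 0 < ∏ j, Λ j ξ ^ α j := Finset.prod_pos fun j _ => pow_pos (hΛ0 j) _
  rw [Real.rpow_add hj, Real.rpow_one] at h2
  have h3 : P ^ k = P ^ N * P ^ (k - N) := by rw [← pow_add, Nat.add_sub_cancel' hNk]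
  have hQ : 0 < P ^ (k - N) := by positivity
  have hck : 0 < c ^ (k - N) := by positivity
  set E := jb ξ ^ (C * (∑ j, α j : ℕ)) with hE
  have hE0 : 0 < E := by positivity
  have h4 : jb ξ * ∏ j, Λ j ξ ^ α j ≤ C ^ (∑ j, α j) * (c ^ (k - N))⁻¹ * P ^ (k - N) := by
    calc jb ξ * ∏ j, Λ j ξ ^ α j ≤ jb ξ * (C ^ (∑ j, α j) * E) := by gcongr
      _ = C ^ (∑ j, α j) * (c ^ (k - N))⁻¹ * (c ^ (k - N) * (E * jb ξ)) := by
          field_simp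
      _ ≤ _ := by gcongr
  rw [h3, mul_inv]
  have h5 : (P ^ (k - N))⁻¹ ≤ C ^ (∑ j, α j) * (c ^ (k - N))⁻¹ * (jb ξ)⁻¹ *
      (∏ j, Λ j ξ ^ α j)⁻¹ := by
    rw [mul_assoc _ (jb ξ)⁻¹, ← mul_inv, ← div_eq_mul_inv, le_div_iff₀ (by positivity),
      inv_mul_le_iff₀ hQ]
    linarith
  calc (P ^ N)⁻¹ * (P ^ (k - N))⁻¹ ≤ (P ^ N)⁻¹ * (C ^ (∑ j, α j) * (c ^ (k - N))⁻¹ * (jb ξ)⁻¹ *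
      (∏ j, Λ j ξ ^ α j)⁻¹) := by gcongr
    _ = _ := by ring

lemma exhaustion {Ω : Set (Euc n)} (hΩ : IsOpen Ω) :
    ∃ Q : ℕ → Set (Euc n), (∀ k, IsCompact (Q k)) ∧ (∀ k, Q k ⊆ Ω) ∧
      ∀ K, IsCompact K → K ⊆ Ω → ∃ k0, ∀ k ≥ k0, K ⊆ Q k := by
  have : LocallyCompactSpace Ω := hΩ.locallyCompactSpace
  let E : CompactExhaustion Ω := CompactExhaustion.choice Ω
  refine ⟨fun k => Subtype.val '' (E k), fun k => (E.isCompact k).image continuous_subtype_val,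
    fun k => by rintro _ ⟨y, _, rfl⟩; exact y.2, fun K hK hKΩ => ?_⟩
  have hK' : IsCompact (Subtype.val ⁻¹' K : Set Ω) := by
    rw [Subtype.isCompact_iff, Subtype.image_preimage_coe, Set.inter_eq_right.2 hKΩ]
    exact hK
  obtain ⟨k0, hk0⟩ := E.exists_superset_of_isCompact hK'
  exact ⟨k0, fun k hk x hx => ⟨⟨x, hKΩ hx⟩, E.subset hk (hk0 hx), rfl⟩⟩

/-- existence of asymptotic sums `a ∼ Σ_k a_k`, `a_k ∈ S_{m·π^{-k},Λ}(Ω)`. -/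
theorem stmt_11 {n : ℕ} (hn : 0 < n) (Ω : Set (Euc n)) (hΩ : IsOpen Ω)
    (Λ : Fin n → Euc n → ℝ) (hΛ : IsWeightVector Λ)
    (m : Euc n → ℝ) (hm : IsAdmissible Λ m)
    (A : ℕ → Euc n → Euc n → ℂ)
    (hA : ∀ k : ℕ, IsSymbol Ω (fun ξ => m ξ * ((⨅ j, Λ j ξ) ^ k)⁻¹) Λ (A k)) :
    ∃ a : Euc n → Euc n → ℂ, IsSymbol Ω m Λ a ∧
      ∀ N : ℕ, 1 ≤ N →
        IsSymbol Ω (fun ξ => m ξ * ((⨅ j, Λ j ξ) ^ N)⁻¹) Λ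
          (fun x ξ => a x ξ - ∑ k ∈ Finset.range N, A k x ξ) := by
  classical
  obtain ⟨hΛc, hΛ0, C, c, hC, hc, hpg, -, -⟩ := hΛ
  obtain ⟨hmc, hm0, -⟩ := hm
  have hne : Nonempty (Fin n) := ⟨⟨0, hn⟩⟩
  have hΛl : ∀ j ξ, c ≤ Λ j ξ := fun j ξ => by
    refine le_trans ?_ (hpg j ξ).1
    have := Real.one_le_rpow (one_le_jb ξ) hc.le
    nlinarith
  have hPl : ∀ ξ, c ≤ ⨅ j, Λ j ξ := fun ξ => le_ciInf fun j => hΛl j ξ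
  have hP0 : ∀ ξ, 0 < ⨅ j, Λ j ξ := fun ξ => lt_of_lt_of_le hc (hPl ξ)
  have hPu : ∀ ξ, (⨅ j, Λ j ξ) ≤ Λ ⟨0, hn⟩ ξ := fun ξ =>
    ciInf_le (Set.finite_range _).bddBelow _
  have hpr : ∀ (α : Fin n → ℕ) ξ, 0 < ∏ k, Λ k ξ ^ α k := fun α ξ =>
    Finset.prod_pos fun k _ => pow_pos (hΛ0 k ξ) _
  have hW : ∀ N ξ, 0 < m ξ * ((⨅ j, Λ j ξ) ^ N)⁻¹ := fun N ξ =>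
    mul_pos (hm0 ξ) (inv_pos.2 (pow_pos (hP0 ξ) N))
  have hO := isOpen_dom (n := n) hΩ
  have hAs : ∀ k, ContDiffOn ℝ (⊤ : ℕ∞) (UU (A k)) (Ω ×ˢ Set.univ) := fun k => (hA k).1
  obtain ⟨Q, hQc, hQΩ, hQ⟩ := exhaustion hΩ
  -- choice of radii
  have hrad : ∀ k : ℕ, ∃ R : ℝ, 1 ≤ R ∧ (k : ℝ) + 1 ≤ R ∧
      ∀ (α β : Fin n → ℕ) (N : ℕ), (∀ j, α j ≤ k) → (∀ j, β j ≤ k) → N ≤ k →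
        C * (∑ j, α j : ℕ) + 1 ≤ c * ((k : ℝ) - N) → ∀ x ∈ Q k, ∀ ξ, R ≤ ‖ξ‖ →
        ‖DW (canw α β) (A k) x ξ‖ + ‖DW (canw α β) (fun x ξ => cut R ξ • A k x ξ) x ξ‖ ≤
          (1 / 2) ^ k * (m ξ * ((⨅ j, Λ j ξ) ^ N)⁻¹ * (∏ j, Λ j ξ ^ α j)⁻¹) := by
    intro k
    let S : Set ((Fin n → ℕ) × (Fin n → ℕ) × ℕ) :=
      {t | t.2.2 ≤ k ∧ C * (∑ j, t.1 j : ℕ) + 1 ≤ c * ((k : ℝ) - t.2.2)} ∩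
        Set.Iic ((fun _ => k), (fun _ => k), k)
    have hS : S.Finite := (Set.finite_Iic _).subset Set.inter_subset_right
    have hev : ∀ t ∈ S, ∀ᶠ R : ℝ in Filter.atTop, ∀ x ∈ Q k, ∀ ξ, R ≤ ‖ξ‖ →
        ‖DW (canw t.1 t.2.1) (A k) x ξ‖ +
          ‖DW (canw t.1 t.2.1) (fun x ξ => cut R ξ • A k x ξ) x ξ‖ ≤
          (1 / 2) ^ k * (m ξ * ((⨅ j, Λ j ξ) ^ t.2.2)⁻¹ * (∏ j, Λ j ξ ^ t.1 j)⁻¹) := by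
      rintro ⟨α, β, N⟩ ⟨⟨hN, hcond⟩, -⟩
      obtain ⟨C0, hC0, hcr⟩ := crude hΩ (hW k) hc hΛl (hA k) (hQc k) (hQΩ k) α β
      obtain ⟨B, hB, hwb⟩ := weightBound hn hC hc hpg k N α hN hcond
      filter_upwards [Filter.eventually_ge_atTop (1 : ℝ),
        Filter.eventually_ge_atTop (2 * C0 * B * 2 ^ k)] with R hR1 hR2 x hx ξ hξ
      obtain ⟨h1, h2⟩ := hcr R hR1 x hx ξ
      have hmξ := hm0 ξ
      set w := ((⨅ j, Λ j ξ) ^ N)⁻¹ * (∏ j, Λ j ξ ^ α j)⁻¹ with hw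
      have hw0 : 0 < w := mul_pos (inv_pos.2 (pow_pos (hP0 ξ) N)) (inv_pos.2 (hpr α ξ))
      have hjR : R ≤ jb ξ := hξ.trans (norm_le_jb ξ)
      have hjp : 0 < jb ξ := by linarith
      have h3 : 2 * C0 * B * (jb ξ)⁻¹ ≤ (1 / 2) ^ k := by
        rw [← div_eq_mul_inv, div_le_iff₀ hjp, one_div, inv_pow, ← div_eq_inv_mul,
          le_div_iff₀ (by positivity)]
        linarith
      calc _ ≤ 2 * C0 * (m ξ * ((⨅ j, Λ j ξ) ^ k)⁻¹) := by linarith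
        _ ≤ 2 * C0 * (m ξ * (B * (jb ξ)⁻¹ * w)) := by
            have := hwb ξ
            gcongr
        _ = (2 * C0 * B * (jb ξ)⁻¹) * (m ξ * w) := by ring
        _ ≤ (1 / 2) ^ k * (m ξ * w) := by gcongr
        _ = _ := by rw [hw, mul_assoc]
    have hall := (Filter.eventually_all_finite hS).2 hev
    obtain ⟨R, hR⟩ := (hall.and ((Filter.eventually_ge_atTop (1 : ℝ)).and
      (Filter.eventually_ge_atTop ((k : ℝ) + 1)))).exists
    exact ⟨R, hR.2.1, hR.2.2, fun α β N hα hβ hN hcond =>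
      hR.1 (α, β, N) ⟨⟨hN, hcond⟩, ⟨hα, hβ, hN⟩⟩⟩
  choose R hR1 hRk hR using hrad
  let f : ℕ → Euc n → Euc n → ℂ := fun k x ξ => A k x ξ - cut (R k) ξ • A k x ξ
  let a : Euc n → Euc n → ℂ := fun x ξ => ∑' k, f k x ξ
  have ha : ∀ (M : ℕ) x ξ, ‖ξ‖ < M → a x ξ = ∑ k ∈ Finset.range M, f k x ξ := by
    intro M x ξ hξ
    apply tsum_eq_sum
    intro k hk
    have hk' : (M : ℝ) ≤ k := by simpa using hk
    have : cut (R k) ξ = 1 := cut_one (hR1 k) (by linarith [hRk k])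
    simp only [f, this, one_smul, sub_self]
  have main : ∀ N : ℕ, IsSymbol Ω (fun ξ => m ξ * ((⨅ j, Λ j ξ) ^ N)⁻¹) Λ
      (fun x ξ => a x ξ - ∑ k ∈ Finset.range N, A k x ξ) := by
    intro N
    let A' : ℕ → Euc n → Euc n → ℂ := fun k => if k < N then fun _ _ => 0 else A k
    let g : ℕ → Euc n → Euc n → ℂ := fun k x ξ => A' k x ξ - cut (R k) ξ • A k x ξ
    have hA's : ∀ k, ContDiffOn ℝ (⊤ : ℕ∞) (UU (A' k)) (Ω ×ˢ Set.univ) := by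
      intro k
      by_cases hk : k < N
      · simp only [A', hk, if_true]; exact contDiffOn_const
      · simp only [A', hk, if_false]; exact hAs k
    have hcs : ∀ k, ContDiffOn ℝ (⊤ : ℕ∞) (UU fun x ξ => cut (R k) ξ • A k x ξ)
        (Ω ×ˢ Set.univ) := fun k => smul_smooth (cut_smooth _) (hAs k)
    have hgs : ∀ k, ContDiffOn ℝ (⊤ : ℕ∞) (UU (g k)) (Ω ×ˢ Set.univ) :=
      fun k => (hA's k).sub (hcs k)
    have hag : ∀ (M : ℕ), N ≤ M → ∀ x ξ, ‖ξ‖ < M →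
        a x ξ - ∑ k ∈ Finset.range N, A k x ξ = ∑ k ∈ Finset.range M, g k x ξ := by
      intro M hM x ξ hξ
      have h1 : ∑ k ∈ Finset.range N, A k x ξ =
          ∑ k ∈ Finset.range M, if k < N then A k x ξ else 0 := by
        rw [← Finset.sum_filter]
        congr 1
        ext k; simp only [Finset.mem_range, Finset.mem_filter]; omega
      rw [ha M x ξ hξ, h1, ← Finset.sum_sub_distrib]
      apply Finset.sum_congr rfl
      intro k _
      by_cases hk : k < N
      · simp [f, g, A', hk]
      · simp [f, g, A', hk]
    have hopenM : ∀ M : ℕ, IsOpen {p : Euc n × Euc n | ‖p.2‖ < M} := fun M =>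
      isOpen_lt continuous_snd.norm continuous_const
    constructor
    · rintro ⟨x, ξ⟩ hp
      obtain ⟨M0, hM0⟩ := exists_nat_gt ‖ξ‖
      have hM : ‖ξ‖ < (max M0 N : ℕ) := hM0.trans_le (by exact_mod_cast le_max_left _ _)
      have hs : ContDiffOn ℝ (⊤ : ℕ∞) (fun p => ∑ k ∈ Finset.range (max M0 N), UU (g k) p)
          (Ω ×ˢ Set.univ) := ContDiffOn.sum fun k _ => hgs k
      refine ((hs.contDiffAt (hO.mem_nhds hp)).congr_of_eventuallyEq ?_).contDiffWithinAt
      filter_upwards [(hopenM (max M0 N)).mem_nhds hM] with q hq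
      exact hag (max M0 N) (le_max_right _ _) q.1 q.2 hq
    · intro K hK hKΩ α β
      -- individual bounds
      have hind : ∀ k, ∃ e : ℝ, ∀ x ∈ K, ∀ ξ, ‖DW (canw α β) (g k) x ξ‖ ≤
          e * (m ξ * ((⨅ j, Λ j ξ) ^ N)⁻¹ * (∏ j, Λ j ξ ^ α j)⁻¹) := by
        intro k
        have hgpos : ∀ ξ, 0 < m ξ * (Λ ⟨0, hn⟩ ξ ^ N)⁻¹ * (∏ j, Λ j ξ ^ α j)⁻¹ := fun ξ =>
          mul_pos (mul_pos (hm0 ξ) (inv_pos.2 (pow_pos (hΛ0 _ ξ) N))) (inv_pos.2 (hpr α ξ))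
        have hgcont : Continuous fun ξ =>
            m ξ * (Λ ⟨0, hn⟩ ξ ^ N)⁻¹ * (∏ j, Λ j ξ ^ α j)⁻¹ := by
          refine (hmc.mul (((hΛc _).pow N).inv₀ fun ξ => (pow_pos (hΛ0 _ ξ) N).ne')).mul
            (Continuous.inv₀ ?_ fun ξ => (hpr α ξ).ne')
          exact continuous_finsetProd _ fun j _ => (hΛc j).pow _
        obtain ⟨e1, he1, h1⟩ := compactPiece hΩ hgpos hgcont (hAs k) hK hKΩ (canw α β) (hR1 k)
        have h1' : ∀ x ∈ K, ∀ ξ, ‖DW (canw α β) (fun x ξ => cut (R k) ξ • A k x ξ) x ξ‖ ≤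
            e1 * (m ξ * ((⨅ j, Λ j ξ) ^ N)⁻¹ * (∏ j, Λ j ξ ^ α j)⁻¹) := by
          intro x hx ξ
          refine (h1 x hx ξ).trans ?_
          have a1 := hm0 ξ
          have a2 := hpr α ξ
          have a3 := hP0 ξ
          have a4 := hPu ξ
          gcongr
        have h2 : ∃ e2 : ℝ, ∀ x ∈ K, ∀ ξ, ‖DW (canw α β) (A' k) x ξ‖ ≤
            e2 * (m ξ * ((⨅ j, Λ j ξ) ^ N)⁻¹ * (∏ j, Λ j ξ ^ α j)⁻¹) := by
          by_cases hk : k < N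
          · refine ⟨0, fun x _ ξ => ?_⟩
            simp only [A', hk, if_true, DW_zero]
            simp
          · simp only [A', hk, if_false]
            obtain ⟨e, he, h⟩ := (hA k).2 K hK hKΩ α β
            refine ⟨e * (c ^ (k - N))⁻¹, fun x hx ξ => ?_⟩
            rw [DW_canw]
            refine (h x hx ξ).trans ?_
            have a1 := hm0 ξ
            have a2 := hpr α ξ
            have a3 := hP0 ξ
            have a4 := hPl ξ
            have a5 : ((⨅ j, Λ j ξ) ^ k)⁻¹ ≤ (c ^ (k - N))⁻¹ * ((⨅ j, Λ j ξ) ^ N)⁻¹ := by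
              rw [← mul_inv]
              apply inv_anti₀ (by positivity)
              calc c ^ (k - N) * (⨅ j, Λ j ξ) ^ N
                  ≤ (⨅ j, Λ j ξ) ^ (k - N) * (⨅ j, Λ j ξ) ^ N := by gcongr
                _ = _ := by rw [← pow_add, Nat.sub_add_cancel (not_lt.1 hk)]
            calc e * (m ξ * ((⨅ j, Λ j ξ) ^ k)⁻¹) * (∏ j, Λ j ξ ^ α j)⁻¹
                ≤ e * (m ξ * ((c ^ (k - N))⁻¹ * ((⨅ j, Λ j ξ) ^ N)⁻¹)) *
                  (∏ j, Λ j ξ ^ α j)⁻¹ := by gcongr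
              _ = _ := by ring
        obtain ⟨e2, h2⟩ := h2
        refine ⟨e2 + e1, fun x hx ξ => ?_⟩
        rw [DW_sub hO (hA's k) (hcs k) (canw α β) (x, ξ) ⟨hKΩ hx, trivial⟩, add_mul]
        exact (norm_sub_le _ _).trans (add_le_add (h2 x hx ξ) (h1' x hx ξ))
      choose e he using hind
      -- tail bounds
      obtain ⟨kK, hkK⟩ := hQ K hK hKΩ
      obtain ⟨k1, hk1⟩ := exists_nat_ge ((C * (∑ j, α j : ℕ) + 1) / c + N)
      have htail : ∃ k0, ∀ k ≥ k0, ∀ x ∈ K, ∀ ξ, ‖DW (canw α β) (g k) x ξ‖ ≤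
          (1 / 2) ^ k * (m ξ * ((⨅ j, Λ j ξ) ^ N)⁻¹ * (∏ j, Λ j ξ ^ α j)⁻¹) := by
        refine ⟨kK + k1 + N + ∑ j, α j + ∑ j, β j, fun k hk x hx ξ => ?_⟩
        have hkN : ¬ k < N := by omega
        have hpos : 0 < m ξ * ((⨅ j, Λ j ξ) ^ N)⁻¹ * (∏ j, Λ j ξ ^ α j)⁻¹ :=
          mul_pos (hW N ξ) (inv_pos.2 (hpr α ξ))
        have hA'k : A' k = A k := by simp only [A', hkN, if_false]
        by_cases hξ : ‖ξ‖ < R k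
        · have hop : IsOpen {p : Euc n × Euc n | ‖p.2‖ < R k} :=
            isOpen_lt continuous_snd.norm continuous_const
          have h0 := DW_congr hop (f := g k) (g := fun _ _ => 0)
            (fun p hp => by
              simp only [g, hA'k]
              rw [cut_one (hR1 k) (le_of_lt hp), one_smul, sub_self]) (canw α β) (x, ξ) hξ
          rw [DW_zero] at h0
          change DW (canw α β) (g k) x ξ = 0 at h0
          rw [h0, norm_zero]
          positivity
        · have hα : ∀ j, α j ≤ k := fun j => by
            have := Finset.single_le_sum (f := α) (fun i _ => Nat.zero_le _) (Finset.mem_univ j)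
            omega
          have hβ : ∀ j, β j ≤ k := fun j => by
            have := Finset.single_le_sum (f := β) (fun i _ => Nat.zero_le _) (Finset.mem_univ j)
            omega
          have hcond : C * (∑ j, α j : ℕ) + 1 ≤ c * ((k : ℝ) - N) := by
            have hk1k : (k1 : ℝ) ≤ k := by exact_mod_cast (by omega : k1 ≤ k)
            have : (C * (∑ j, α j : ℕ) + 1) / c ≤ (k : ℝ) - N := by linarith
            rw [div_le_iff₀ hc] at this
            linarith
          rw [DW_sub hO (hA's k) (hcs k) (canw α β) (x, ξ) ⟨hKΩ hx, trivial⟩, hA'k]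
          exact (norm_sub_le _ _).trans (hR k α β N hα hβ (not_lt.1 hkN) hcond x
            (hkK k (by omega) hx) ξ (not_lt.1 hξ))
      obtain ⟨k0, hk0⟩ := htail
      let e' : ℕ → ℝ := fun k => if k < k0 then |e k| else (1 / 2) ^ k
      have he'0 : ∀ k, 0 ≤ e' k := fun k => by
        by_cases hk : k < k0
        · simp only [e', hk, if_true]; positivity
        · simp only [e', hk, if_false]; positivity
      have he's : Summable e' := by
        rw [← summable_nat_add_iff k0]
        have hgeo : Summable fun k : ℕ => ((1 : ℝ) / 2) ^ (k + k0) :=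
          (summable_nat_add_iff k0).2 summable_geometric_two
        refine hgeo.congr fun k => ?_
        have : ¬ k + k0 < k0 := by omega
        simp only [e', this, if_false]
      refine ⟨∑' k, e' k + 1, by
        have h0 : 0 ≤ ∑' k, e' k := tsum_nonneg he'0
        linarith, fun x hx ξ => ?_⟩
      have hpos : 0 < m ξ * ((⨅ j, Λ j ξ) ^ N)⁻¹ * (∏ j, Λ j ξ ^ α j)⁻¹ :=
        mul_pos (hW N ξ) (inv_pos.2 (hpr α ξ))
      obtain ⟨M0, hM0⟩ := exists_nat_gt ‖ξ‖
      have hM : ‖ξ‖ < (max M0 N : ℕ) := hM0.trans_le (by exact_mod_cast le_max_left _ _)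
      have hcg := DW_congr (hopenM (max M0 N))
        (f := fun x ξ => a x ξ - ∑ k ∈ Finset.range N, A k x ξ)
        (g := fun x ξ => ∑ k ∈ Finset.range (max M0 N), g k x ξ)
        (fun p hp => hag _ (le_max_right _ _) p.1 p.2 hp) (canw α β) (x, ξ) hM
      have hsm := DW_sum hO hgs (Finset.range (max M0 N)) (canw α β) (x, ξ) ⟨hKΩ hx, trivial⟩
      rw [← DW_canw]
      change DW (canw α β) (fun x ξ => a x ξ - ∑ k ∈ Finset.range N, A k x ξ) x ξ = _ at hcg
      rw [hcg, hsm]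
      calc _ ≤ ∑ k ∈ Finset.range (max M0 N), ‖DW (canw α β) (g k) x ξ‖ := norm_sum_le _ _
        _ ≤ ∑ k ∈ Finset.range (max M0 N),
            e' k * (m ξ * ((⨅ j, Λ j ξ) ^ N)⁻¹ * (∏ j, Λ j ξ ^ α j)⁻¹) := by
            apply Finset.sum_le_sum
            intro k _
            by_cases hk : k < k0
            · simp only [e', hk, if_true]
              refine (he k x hx ξ).trans ?_
              gcongr
              exact le_abs_self _
            · simp only [e', hk, if_false]
              exact hk0 k (not_lt.1 hk) x hx ξ
        _ = (∑ k ∈ Finset.range (max M0 N), e' k) *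
            (m ξ * ((⨅ j, Λ j ξ) ^ N)⁻¹ * (∏ j, Λ j ξ ^ α j)⁻¹) := by
            rw [Finset.sum_mul]
        _ ≤ (∑' k, e' k + 1) *
            (m ξ * ((⨅ j, Λ j ξ) ^ N)⁻¹ * (∏ j, Λ j ξ ^ α j)⁻¹) := by
            gcongr
            linarith [he's.sum_le_tsum (Finset.range (max M0 N)) fun k _ => he'0 k]
        _ = _ := by ring
  refine ⟨a, ?_, fun N _ => main N⟩
  simpa using main 0

end
end

section
/- Let Λ be a weight vector on ℝ^n. For every ε > 0 and every subset X ⊆ ℝ^n there exists a smooth function σ : ℝ^n → ℝ satisfying, for every multi-index α, |∂^α σ(ξ)| ≤ c_α Λ(ξ)^{-α} for all ξ (zero-order global estimates), such that supp σ ⊆ X_{εΛ} and σ(ξ) = 1 for all ξ ∈ X_{ε'Λ}, for a suitable ε' with 0 < ε' < ε depending only on ε and Λ. -/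
open scoped BigOperators RealInnerProductSpace
open MeasureTheory

noncomputable section

variable {n : ℕ} {F : Type*} [NormedAddCommGroup F] [NormedSpace ℝ F]

/-- Iterated partial derivatives along a list of directions. -/
theorem aux_foldr_flatMap {n : ℕ} (α : Fin n → ℕ) (f : Euc n → ℝ) (L : List (Fin n)) :
    L.foldr (fun j g => (pd j)^[α j] g) f =
      (L.flatMap (fun j => List.replicate (α j) j)).foldr (fun j g => pd j g) f := by
  induction L with
  | nil => rfl
  | cons a L ih =>
    rw [List.flatMap_cons, List.foldr_append, ← ih, List.foldr_cons]
    generalize List.foldr (fun j g => (pd j)^[α j] g) f L = g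
    generalize α a = m
    induction m with
    | zero => rfl
    | succ m ihm =>
      rw [Function.iterate_succ_apply', ihm, List.replicate_succ, List.foldr_cons]

theorem aux_prod_flatMap {n : ℕ} (α : Fin n → ℕ) (w : Fin n → ℝ) (L : List (Fin n)) :
    ((L.flatMap (fun j => List.replicate (α j) j)).map w).prod =
      (L.map (fun j => w j ^ α j)).prod := by
  induction L with
  | nil => rfl
  | cons a L ih =>
    rw [List.flatMap_cons, List.map_append, List.prod_append, ih]
    simp

theorem aux_foldr_pd {n : ℕ} (f : Euc n → ℝ) (hf : ContDiff ℝ (⊤ : ℕ∞) f) (l : List (Fin n))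
    (ξ : Euc n) :
    l.foldr (fun j g => pd j g) f ξ =
      iteratedFDeriv ℝ l.length f ξ (fun i => EuclideanSpace.single (l.get i) (1 : ℝ)) := by
  induction l generalizing ξ with
  | nil => simp
  | cons a l ih =>
    have h : l.foldr (fun j g => pd j g) f = fun ξ =>
      iteratedFDeriv ℝ l.length f ξ (fun i => EuclideanSpace.single (l.get i) (1 : ℝ)) :=
      funext ih
    have hd : Differentiable ℝ (iteratedFDeriv ℝ l.length f) :=
      ContDiff.differentiable_iteratedFDeriv (by exact_mod_cast WithTop.coe_lt_top _) hf
    rw [List.foldr_cons, h]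
    unfold pd
    rw [fderiv_continuousMultilinear_apply_const_apply (hd ξ)]
    simp only [List.length_cons]
    rw [iteratedFDeriv_succ_apply_left]
    rfl

/-- Slow variation in box form. -/
theorem aux_sw {n : ℕ} (Λ : Fin n → Euc n → ℝ) (hΛ : IsWeightVector Λ) :
    ∃ K r : ℝ, 1 ≤ K ∧ 0 < r ∧ ∀ ξ η : Euc n, (∀ k, |ξ k - η k| ≤ r * Λ k η) →
      ∀ j, Λ j ξ ≤ K * Λ j η ∧ Λ j η ≤ K * Λ j ξ := by
  obtain ⟨-, hpos, C, c, hC, hc, -, -, hsw⟩ := hΛ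
  refine ⟨max C 1, c / (n + 1), le_max_right _ _, by positivity, fun ξ η h j => ?_⟩
  have hs : ∑ k, |ξ k - η k| * (Λ k η)⁻¹ ≤ c := by
    calc ∑ k, |ξ k - η k| * (Λ k η)⁻¹ ≤ ∑ k : Fin n, c / (n + 1) := by
          apply Finset.sum_le_sum
          intro k _
          rw [← div_eq_mul_inv, div_le_iff₀ (hpos k η)]
          exact h k
      _ = c * (n / (n + 1)) := by simp; ring
      _ ≤ c * 1 := by
          gcongr
          rw [div_le_one (by positivity)]
          linarith
      _ = c := mul_one c
  obtain ⟨h1, h2⟩ := hsw ξ η hs j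
  rw [inv_mul_le_iff₀ hC] at h1
  exact ⟨h1.trans (mul_le_mul_of_nonneg_right (le_max_left _ _) (hpos j η).le),
    h2.trans (mul_le_mul_of_nonneg_right (le_max_left _ _) (hpos j ξ).le)⟩

/-- Packing bound. -/
theorem aux_pack (n : ℕ) (R s : ℝ) (hs : 0 < s) : ∃ N : ℕ, ∀ (S : Set (Euc n))
    (T : Euc n → (Fin n → ℝ)), (∀ i ∈ S, ‖T i‖ ≤ R) →
      (∀ i ∈ S, ∀ j ∈ S, i ≠ j → s ≤ dist (T i) (T j)) → S.Finite ∧ S.ncard ≤ N := by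
  obtain ⟨t, -, ht, hcov⟩ := finite_cover_balls_of_compact
    (isCompact_closedBall (0 : Fin n → ℝ) R) (half_pos hs)
  refine ⟨t.ncard, fun S T hT hsep => ?_⟩
  have h : ∀ i : Euc n, ∃ y : Fin n → ℝ, i ∈ S → y ∈ t ∧ dist (T i) y < s / 2 := by
    intro i
    by_cases hi : i ∈ S
    · have := hcov (show T i ∈ Metric.closedBall 0 R by simpa using hT i hi)
      simp only [Set.mem_iUnion, Metric.mem_ball] at this
      obtain ⟨y, hy, hd⟩ := this
      exact ⟨y, fun _ => ⟨hy, hd⟩⟩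
    · exact ⟨0, fun h => absurd h hi⟩
  choose g hg using h
  have hmaps : ∀ a ∈ S, g a ∈ t := fun a ha => (hg a ha).1
  have hinj : Set.InjOn g S := by
    intro a ha b hb hab
    by_contra hne
    have h1 := hsep a ha b hb hne
    have h2 := (hg a ha).2
    have h3 := (hg b hb).2
    rw [← hab] at h3
    have := dist_triangle_right (T a) (T b) (g a)
    linarith
  exact ⟨Set.Finite.of_injOn hmaps hinj ht, Set.ncard_le_ncard_of_injOn g hmaps hinj ht⟩

/-- Maximal separated subsets. -/
theorem aux_maximal {E : Type*} (r : E → E → Prop) (hr : ∀ x y, r x y → r y x) (X : Set E) :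
    ∃ I ⊆ X, I.Pairwise r ∧ ∀ x ∈ X, x ∈ I ∨ ∃ y ∈ I, ¬ r x y := by
  obtain ⟨I, hI⟩ := zorn_subset {J : Set E | J ⊆ X ∧ J.Pairwise r} (by
    intro c hc hch
    refine ⟨⋃₀ c, ⟨Set.sUnion_subset fun s hs => (hc hs).1, ?_⟩,
      fun s hs => Set.subset_sUnion_of_mem hs⟩
    rw [Set.pairwise_sUnion hch.directedOn]
    exact fun a ha => (hc ha).2)
  refine ⟨I, hI.prop.1, hI.prop.2, fun x hx => ?_⟩
  by_contra! hcon
  obtain ⟨hxI, hall⟩ := hcon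
  have : insert x I ⊆ I := hI.le_of_ge (y := insert x I)
    ⟨Set.insert_subset hx hI.prop.1, hI.prop.2.insert fun b hb _ =>
      ⟨hall b hb, hr _ _ (hall b hb)⟩⟩ (Set.subset_insert x I)
  exact hxI (this (Set.mem_insert x I))

/-- Rescaling map `ξ ↦ (ξ_k / w_k)`. -/
def auxM {n : ℕ} (w : Fin n → ℝ) : Euc n →L[ℝ] (Fin n → ℝ) :=
  ContinuousLinearMap.pi fun k => (w k)⁻¹ • EuclideanSpace.proj k

theorem auxM_apply {n : ℕ} (w : Fin n → ℝ) (ξ : Euc n) (k : Fin n) :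
    auxM w ξ k = (w k)⁻¹ * ξ k := by
  simp [auxM]

/-- Rescaling map `t ↦ (w_k t_k)`. -/
def auxL {n : ℕ} (w : Fin n → ℝ) : (Fin n → ℝ) →L[ℝ] Euc n :=
  ((EuclideanSpace.equiv (Fin n) ℝ).symm : (Fin n → ℝ) →L[ℝ] Euc n).comp
    (ContinuousLinearMap.pi fun k => w k • ContinuousLinearMap.proj k)

theorem auxL_apply {n : ℕ} (w : Fin n → ℝ) (t : Fin n → ℝ) (k : Fin n) :
    auxL w t k = w k * t k := by
  simp [auxL]

theorem auxL_single {n : ℕ} (w : Fin n → ℝ) (j : Fin n) :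
    auxL w (Pi.single j 1) = w j • EuclideanSpace.single j (1 : ℝ) := by
  ext k
  rw [auxL_apply]
  by_cases h : k = j
  · subst h; simp
  · simp [h]

theorem aux_norm_comp {n : ℕ} (w v : Fin n → ℝ) (hw : ∀ k, 0 < w k) (hv : ∀ k, 0 < v k) (K : ℝ)
    (hK : 0 ≤ K) (h : ∀ k, v k ≤ K * w k) : ‖(auxM w).comp (auxL v)‖ ≤ K := by
  refine ContinuousLinearMap.opNorm_le_bound _ hK fun t => ?_
  rw [pi_norm_le_iff_of_nonneg (by positivity)]
  intro k
  rw [ContinuousLinearMap.comp_apply, auxM_apply, auxL_apply, ← mul_assoc, norm_mul]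
  have h1 : ‖(w k)⁻¹ * v k‖ ≤ K := by
    rw [Real.norm_of_nonneg (mul_nonneg (inv_nonneg.2 (hw k).le) (hv k).le),
      inv_mul_le_iff₀ (hw k), mul_comm]
    exact h k
  exact mul_le_mul h1 (norm_le_pi_norm t k) (norm_nonneg _) hK

/-- Reduction of the mixed partial derivative bounds to a bound on rescaled functions. -/
theorem aux_mpd_bound {n : ℕ} (w : Fin n → ℝ) (hw : ∀ k, 0 < w k) (σ : Euc n → ℝ)
    (hσ : ContDiff ℝ (⊤ : ℕ∞) σ) (α : Fin n → ℕ) (ξ0 : Euc n) (B : ℝ)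
    (hB : ‖iteratedFDeriv ℝ ((List.finRange n).flatMap
      (fun j => List.replicate (α j) j)).length (fun t => σ (ξ0 + auxL w t)) 0‖ ≤ B) :
    ‖mpd α σ ξ0‖ ≤ B * (∏ k, w k ^ α k)⁻¹ := by
  set l := (List.finRange n).flatMap (fun j => List.replicate (α j) j) with hl
  have hprod : ∏ i, w (l.get i) = ∏ k, w k ^ α k := by
    rw [Fin.prod_univ_def (fun k => w k ^ α k), ← aux_prod_flatMap, ← hl, ← List.prod_ofFn]
    congr 1
    conv_rhs => rw [← List.ofFn_get l, List.map_ofFn]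
    simp [Function.comp_def]
  have hP : 0 < ∏ k, w k ^ α k := Finset.prod_pos fun k _ => pow_pos (hw k) _
  have e1 : mpd α σ ξ0 =
      iteratedFDeriv ℝ l.length σ ξ0 (fun i => EuclideanSpace.single (l.get i) (1 : ℝ)) := by
    rw [← aux_foldr_pd σ hσ, hl, ← aux_foldr_flatMap]
    rfl
  have hτ : ContDiff ℝ (⊤ : ℕ∞) (fun z => σ (ξ0 + z)) := hσ.comp (by fun_prop)
  have e2 : iteratedFDeriv ℝ l.length (fun t => σ (ξ0 + auxL w t)) 0
      (fun i => Pi.single (l.get i) 1) = (∏ k, w k ^ α k) * mpd α σ ξ0 := by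
    have := ContinuousLinearMap.iteratedFDeriv_comp_right (auxL w) hτ 0 (i := l.length)
      (by exact_mod_cast le_top)
    rw [show (fun t => σ (ξ0 + auxL w t)) = (fun z => σ (ξ0 + z)) ∘ (auxL w) from rfl, this,
      iteratedFDeriv_comp_add_left, ContinuousMultilinearMap.compContinuousLinearMap_apply]
    simp only [auxL_single]
    rw [ContinuousMultilinearMap.map_smul_univ, hprod, map_zero, add_zero, e1, smul_eq_mul]
  have e3 : ‖(∏ k, w k ^ α k) * mpd α σ ξ0‖ ≤ B := by
    rw [← e2]
    refine (ContinuousMultilinearMap.le_opNorm _ _).trans ?_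
    refine le_trans ?_ hB
    refine mul_le_of_le_one_right (norm_nonneg _) ?_
    refine Finset.prod_le_one (fun _ _ => norm_nonneg _) fun i _ => ?_
    rw [Pi.norm_single]
    simp
  rw [norm_mul, Real.norm_of_nonneg hP.le] at e3
  rw [← div_eq_mul_inv, le_div_iff₀ hP, mul_comm]
  exact e3

/-- Bound for a rescaled bump. -/
theorem aux_bump_bound {n : ℕ} (Φ : (Fin n → ℝ) → ℝ) (hΦ : ContDiff ℝ (⊤ : ℕ∞) Φ) (m : ℕ) (B : ℝ)
    (hB : ∀ x, ‖iteratedFDeriv ℝ m Φ x‖ ≤ B) (w v : Fin n → ℝ) (hw : ∀ k, 0 < w k)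
    (hv : ∀ k, 0 < v k) (K : ℝ) (hK : 0 ≤ K) (h : ∀ k, v k ≤ K * w k) (ξ0 η : Euc n)
    (t : Fin n → ℝ) :
    ‖iteratedFDeriv ℝ m (fun t => Φ (auxM w (ξ0 + auxL v t - η))) t‖ ≤ B * K ^ m := by
  have hB0 : 0 ≤ B := (norm_nonneg _).trans (hB 0)
  have hτ : ContDiff ℝ (⊤ : ℕ∞) (fun z => Φ (auxM w (ξ0 - η) + z)) := hΦ.comp (by fun_prop)
  have e : (fun t => Φ (auxM w (ξ0 + auxL v t - η))) =
      (fun z => Φ (auxM w (ξ0 - η) + z)) ∘ ((auxM w).comp (auxL v)) := by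
    funext t
    simp only [Function.comp_apply, ContinuousLinearMap.comp_apply, ← map_add]
    congr 2
    abel
  rw [e, ContinuousLinearMap.iteratedFDeriv_comp_right _ hτ t (i := m)
      (by exact_mod_cast le_top), iteratedFDeriv_comp_add_left]
  refine (ContinuousMultilinearMap.norm_compContinuousLinearMap_le _ _).trans ?_
  rw [Finset.prod_const, Finset.card_univ, Fintype.card_fin]
  exact mul_le_mul (hB _) (pow_le_pow_left₀ (norm_nonneg _) (aux_norm_comp w v hw hv K hK h) m)
    (by positivity) hB0

/-- The symbol estimates for `h ∘ f` with `f` a locally finite sum of rescaled bumps. -/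
theorem aux_estimate {n : ℕ} (Λ : Fin n → Euc n → ℝ) (hpos : ∀ k ξ, 0 < Λ k ξ)
    (Φ : (Fin n → ℝ) → ℝ) (hΦ : ContDiff ℝ (⊤ : ℕ∞) Φ) (hsupp : HasCompactSupport Φ)
    (h : ℝ → ℝ) (hh : ContDiff ℝ (⊤ : ℕ∞) h) (K : ℝ) (hK : 0 ≤ K) (N : ℕ) (f : Euc n → ℝ)
    (hf : ∀ ξ0, ∃ S : Finset (Euc n), S.card ≤ N ∧ (∀ η ∈ S, ∀ k, Λ k ξ0 ≤ K * Λ k η) ∧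
      f =ᶠ[nhds ξ0] fun ξ => ∑ η ∈ S, Φ (auxM (fun k => Λ k η) (ξ - η))) :
    ContDiff ℝ (⊤ : ℕ∞) (h ∘ f) ∧
    ∀ α : Fin n → ℕ, ∃ c > (0:ℝ), ∀ ξ, ‖mpd α (h ∘ f) ξ‖ ≤ c * (∏ k, Λ k ξ ^ α k)⁻¹ := by
  have hterm : ∀ η : Euc n, ContDiff ℝ (⊤ : ℕ∞)
      (fun ξ => Φ (auxM (fun k => Λ k η) (ξ - η))) := fun η => hΦ.comp (by fun_prop)
  have hfs : ContDiff ℝ (⊤ : ℕ∞) f := by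
    rw [contDiff_iff_contDiffAt]
    intro ξ0
    obtain ⟨S, -, -, hS⟩ := hf ξ0
    refine ContDiffAt.congr_of_eventuallyEq ?_ hS
    exact (ContDiff.sum fun η _ => hterm η).contDiffAt
  have hσ : ContDiff ℝ (⊤ : ℕ∞) (h ∘ f) := hh.comp hfs
  refine ⟨hσ, fun α => ?_⟩
  have hBex : ∀ m : ℕ, ∃ B, ∀ x, ‖iteratedFDeriv ℝ m Φ x‖ ≤ B := fun m =>
    (hΦ.continuous_iteratedFDeriv (by exact_mod_cast le_top)).bounded_above_of_compact_support
      (hsupp.iteratedFDeriv m)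
  choose B hB using hBex
  have hB0 : ∀ m, 0 ≤ B m := fun m => (norm_nonneg _).trans (hB m 0)
  -- bounds for the rescaled f
  have hfb : ∀ (ξ0 : Euc n) (m : ℕ),
      ‖iteratedFDeriv ℝ m (fun t => f (ξ0 + auxL (fun k => Λ k ξ0) t)) 0‖ ≤
        N * (B m * K ^ m) := by
    intro ξ0 m
    obtain ⟨S, hcard, hSK, hS⟩ := hf ξ0
    have hcont : Filter.Tendsto (fun t => ξ0 + auxL (fun k => Λ k ξ0) t) (nhds 0) (nhds ξ0) := by
      have : Continuous (fun t => ξ0 + auxL (fun k => Λ k ξ0) t) := by fun_prop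
      simpa using this.tendsto 0
    have he := (hcont.eventually hS)
    have he' : (fun t => f (ξ0 + auxL (fun k => Λ k ξ0) t)) =ᶠ[nhds 0] fun t =>
      ∑ η ∈ S, Φ (auxM (fun k => Λ k η) (ξ0 + auxL (fun k => Λ k ξ0) t - η)) := he
    rw [(he'.iteratedFDeriv ℝ m).eq_of_nhds, iteratedFDeriv_sum]
    · rw [Finset.sum_apply]
      refine (norm_sum_le _ _).trans ?_
      calc _ ≤ ∑ η ∈ S, B m * K ^ m := Finset.sum_le_sum fun η hη =>
            aux_bump_bound Φ hΦ m (B m) (hB m) _ _ (fun k => hpos k η) (fun k => hpos k ξ0) K hK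
              (hSK η hη) ξ0 η 0
        _ = S.card * (B m * K ^ m) := by simp
        _ ≤ N * (B m * K ^ m) := by
            have := hB0 m
            gcongr
    · intro η _
      refine ContDiff.of_le (n := ((⊤ : ℕ∞) : WithTop ℕ∞)) ?_ (by exact_mod_cast le_top)
      exact hΦ.comp (by fun_prop)
  set m := ((List.finRange n).flatMap (fun j => List.replicate (α j) j)).length with hm
  have hval : ∀ ξ, f ξ ∈ Metric.closedBall (0 : ℝ) (N * (B 0 * K ^ 0)) := by
    intro ξ
    have := hfb ξ 0
    rw [norm_iteratedFDeriv_zero] at this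
    simpa using this
  have hCex : ∀ i : ℕ, ∃ C, ∀ ξ, ‖iteratedFDeriv ℝ i h (f ξ)‖ ≤ C := by
    intro i
    obtain ⟨C, hC⟩ := (isCompact_closedBall (0 : ℝ) (N * (B 0 * K ^ 0))).exists_bound_of_continuousOn
      (f := iteratedFDeriv ℝ i h)
      (hh.continuous_iteratedFDeriv (by exact_mod_cast le_top)).continuousOn
    exact ⟨C, fun ξ => hC _ (hval ξ)⟩
  choose C hC using hCex
  have hC0 : ∀ i, 0 ≤ C i := fun i => (norm_nonneg _).trans (hC i 0)
  set C' := ∑ i ∈ Finset.range (m + 1), C i with hC'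
  set D := 1 + ∑ i ∈ Finset.range (m + 1), N * (B i * K ^ i) with hD
  have hnn : ∀ i, 0 ≤ N * (B i * K ^ i) := fun i => by
    have := hB0 i
    positivity
  have hD1 : 1 ≤ D := by
    rw [hD]
    have := Finset.sum_nonneg (s := Finset.range (m + 1)) fun i _ => hnn i
    linarith
  have hC'0 : 0 ≤ C' := Finset.sum_nonneg fun i _ => hC0 i
  refine ⟨m.factorial * C' * D ^ m + 1, by positivity, fun ξ0 => ?_⟩
  refine aux_mpd_bound (fun k => Λ k ξ0) (fun k => hpos k ξ0) _ hσ α ξ0 _ ?_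
  rw [← hm]
  refine le_trans ?_ (le_add_of_nonneg_right zero_le_one)
  have hfA : ContDiff ℝ (⊤ : ℕ∞) (fun t => f (ξ0 + auxL (fun k => Λ k ξ0) t)) :=
    hfs.comp (by fun_prop)
  refine norm_iteratedFDeriv_comp_le hh hfA (by exact_mod_cast le_top) 0 ?_ ?_
  · intro i hi
    refine (hC i _).trans ?_
    exact Finset.single_le_sum (f := C) (fun i _ => hC0 i) (Finset.mem_range.2 (by omega))
  · intro i h1 hi
    refine (hfb ξ0 i).trans ?_
    have h2 : N * (B i * K ^ i) ≤ D := by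
      have := Finset.single_le_sum (f := fun i => N * (B i * K ^ i)) (fun i _ => hnn i)
        (Finset.mem_range.2 (show i < m + 1 by omega))
      rw [hD]
      linarith
    exact h2.trans (le_self_pow₀ hD1 (by omega))

/-- existence of smooth cut-off functions with zero-order estimates,
supported in `X_{εΛ}` and equal to `1` on `X_{ε'Λ}`. -/
theorem stmt_18 {n : ℕ} (Λ : Fin n → Euc n → ℝ) (hΛ : IsWeightVector Λ)
    (ε : ℝ) (hε : 0 < ε) :
    ∃ ε' : ℝ, 0 < ε' ∧ ε' < ε ∧ ∀ X : Set (Euc n), ∃ σ : Euc n → ℝ,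
      ContDiff ℝ (⊤ : ℕ∞) σ ∧
      (∀ α : Fin n → ℕ, ∃ c > (0:ℝ), ∀ ξ, ‖mpd α σ ξ‖ ≤ c * (∏ k, Λ k ξ ^ α k)⁻¹) ∧
      tsupport σ ⊆ lamNbhd Λ ε X ∧
      (∀ ξ ∈ lamNbhd Λ ε' X, σ ξ = 1) := by
  classical
  obtain ⟨K, r, hK, hr, hsw⟩ := aux_sw Λ hΛ
  have hpos := hΛ.2.1
  have hcontΛ := hΛ.1
  have hK0 : 0 < K := by linarith
  set ρ := min r (ε / 2) with hρ
  have hρ0 : 0 < ρ := lt_min hr (half_pos hε)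
  have hρr : ρ ≤ r := min_le_left _ _
  have hρε : ρ ≤ ε / 2 := min_le_right _ _
  set δ := ρ / (4 * K) with hδ
  have hδ0 : 0 < δ := by positivity
  have hKδ : K * δ = ρ / 4 := by rw [hδ]; field_simp
  have hδK : δ ≤ K * δ := le_mul_of_one_le_left hδ0.le hK
  -- the boxes around a point are neighborhoods
  have hbox : ∀ (τ : ℝ), 0 < τ → ∀ ξ0 : Euc n,
      {ξ : Euc n | ∀ k, |ξ k - ξ0 k| < τ * Λ k ξ0} ∈ nhds ξ0 := by
    intro τ hτ ξ0
    have : ∀ k, ∀ᶠ ξ : Euc n in nhds ξ0, |ξ k - ξ0 k| < τ * Λ k ξ0 := by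
      intro k
      have hc : Continuous (fun ξ : Euc n => |ξ k - ξ0 k|) := by fun_prop
      refine hc.continuousAt.eventually_lt continuousAt_const ?_
      simpa using mul_pos hτ (hpos k ξ0)
    exact Filter.eventually_all.2 this
  -- the model bump
  let Φ : ContDiffBump (0 : Fin n → ℝ) := ⟨ρ / 2, ρ, half_pos hρ0, half_lt_self hρ0⟩
  have hΦs : ContDiff ℝ (⊤ : ℕ∞) (Φ : (Fin n → ℝ) → ℝ) := Φ.contDiff
  have hΦne : ∀ ξ η : Euc n, Φ (auxM (fun k => Λ k η) (ξ - η)) ≠ 0 →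
      ∀ k, |ξ k - η k| ≤ ρ * Λ k η := by
    intro ξ η h k
    have h1 : auxM (fun k => Λ k η) (ξ - η) ∈ Function.support Φ := h
    rw [Φ.support_eq, mem_ball_zero_iff] at h1
    have h2 := (norm_le_pi_norm _ k).trans h1.le
    rw [auxM_apply, norm_mul, norm_inv, Real.norm_of_nonneg (hpos k η).le,
      inv_mul_le_iff₀ (hpos k η), mul_comm] at h2
    simpa using h2
  have hΦ1 : ∀ ξ η : Euc n, (∀ k, |ξ k - η k| ≤ ρ / 2 * Λ k η) →
      Φ (auxM (fun k => Λ k η) (ξ - η)) = 1 := by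
    intro ξ η h
    apply Φ.one_of_mem_closedBall
    rw [mem_closedBall_zero_iff]
    change _ ≤ ρ / 2
    rw [pi_norm_le_iff_of_nonneg (by positivity)]
    intro k
    rw [auxM_apply, norm_mul, norm_inv, Real.norm_of_nonneg (hpos k η).le,
      inv_mul_le_iff₀ (hpos k η), mul_comm]
    simpa using h k
  obtain ⟨N, hN⟩ := aux_pack n (ρ * (K * K) + r) (δ / (K * K)) (by positivity)
  refine ⟨δ, hδ0, by linarith, fun X => ?_⟩
  -- the separated set
  obtain ⟨I, hIX, hIsep, hImax⟩ := aux_maximal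
    (fun x y : Euc n => (∃ k, δ * Λ k x ≤ |y k - x k|) ∧ (∃ k, δ * Λ k y ≤ |x k - y k|))
    (fun x y h => ⟨h.2, h.1⟩) X
  let φ : Euc n → Euc n → ℝ := fun η ξ => if η ∈ I then Φ (auxM (fun k => Λ k η) (ξ - η)) else 0
  let f : Euc n → ℝ := fun ξ => ∑ᶠ η, φ η ξ
  have hφne : ∀ η ξ, φ η ξ ≠ 0 → η ∈ I ∧ ∀ k, |ξ k - η k| ≤ ρ * Λ k η := by
    intro η ξ h
    by_cases hη : η ∈ I
    · simp only [φ, if_pos hη] at h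
      exact ⟨hη, hΦne ξ η h⟩
    · simp [φ, hη] at h
  have hφ0 : ∀ η ξ, 0 ≤ φ η ξ := by
    intro η ξ
    simp only [φ]
    split_ifs
    · exact Φ.nonneg
    · exact le_rfl
  -- comparison of weights
  have hcmp : ∀ (ξ0 ξ η : Euc n), (∀ k, |ξ k - ξ0 k| < r * Λ k ξ0) →
      (∀ k, |ξ k - η k| ≤ ρ * Λ k η) → ∀ k, Λ k ξ0 ≤ K * K * Λ k η ∧ Λ k η ≤ K * K * Λ k ξ0 := by
    intro ξ0 ξ η h1 h2 k
    have a := hsw ξ ξ0 (fun k => (h1 k).le) k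
    have b := hsw ξ η (fun k => (h2 k).trans
      (mul_le_mul_of_nonneg_right hρr (hpos k η).le)) k
    constructor
    · calc Λ k ξ0 ≤ K * Λ k ξ := a.2
        _ ≤ K * (K * Λ k η) := by gcongr; exact b.1
        _ = _ := by ring
    · calc Λ k η ≤ K * Λ k ξ := b.2
        _ ≤ K * (K * Λ k ξ0) := by gcongr; exact a.1
        _ = _ := by ring
  -- local finiteness
  have hloc : ∀ ξ0 : Euc n, ∃ S : Finset (Euc n), S.card ≤ N ∧
      (∀ η ∈ S, η ∈ I ∧ ∀ k, Λ k ξ0 ≤ K * K * Λ k η) ∧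
      ∀ ξ : Euc n, (∀ k, |ξ k - ξ0 k| < r * Λ k ξ0) →
        (Function.support fun η => φ η ξ) ⊆ (S : Set (Euc n)) := by
    intro ξ0
    let S : Set (Euc n) := {η | η ∈ I ∧ ∃ ξ : Euc n, (∀ k, |ξ k - ξ0 k| < r * Λ k ξ0) ∧
      ∀ k, |ξ k - η k| ≤ ρ * Λ k η}
    obtain ⟨hfin, hcard⟩ := hN S (fun η => auxM (fun k => Λ k ξ0) (η - ξ0)) (by
      rintro η ⟨-, ξ, h1, h2⟩
      rw [pi_norm_le_iff_of_nonneg (by positivity)]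
      intro k
      rw [auxM_apply, norm_mul, norm_inv, Real.norm_of_nonneg (hpos k ξ0).le,
        inv_mul_le_iff₀ (hpos k ξ0), mul_comm, PiLp.sub_apply, Real.norm_eq_abs]
      have h3 := (hcmp ξ0 ξ η h1 h2 k).2
      calc |η k - ξ0 k| ≤ |η k - ξ k| + |ξ k - ξ0 k| := abs_sub_le _ _ _
        _ ≤ ρ * (K * K * Λ k ξ0) + r * Λ k ξ0 := by
            rw [abs_sub_comm]
            exact add_le_add ((h2 k).trans (by gcongr)) (h1 k).le
        _ = _ := by ring) (by
      rintro η ⟨hη, ξ, h1, h2⟩ η' ⟨hη', -⟩ hne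
      obtain ⟨⟨k, hk⟩, -⟩ := hIsep hη hη' hne
      refine le_trans ?_ (dist_le_pi_dist _ _ k)
      have h3 := (hcmp ξ0 ξ η h1 h2 k).1
      rw [Real.dist_eq, auxM_apply, auxM_apply, ← mul_sub, abs_mul, abs_inv,
        abs_of_pos (hpos k ξ0), le_inv_mul_iff₀ (hpos k ξ0)]
      calc Λ k ξ0 * (δ / (K * K)) ≤ (K * K * Λ k η) * (δ / (K * K)) := by gcongr
        _ = δ * Λ k η := by field_simp
        _ ≤ _ := hk
        _ = _ := by
            rw [abs_sub_comm]
            simp)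
    refine ⟨hfin.toFinset, ?_, ?_, ?_⟩
    · rwa [← Set.ncard_eq_toFinset_card S hfin]
    · intro η hη
      rw [Set.Finite.mem_toFinset] at hη
      obtain ⟨hI, ξ, h1, h2⟩ := hη
      exact ⟨hI, fun k => (hcmp ξ0 ξ η h1 h2 k).1⟩
    · intro ξ hξ
      intro η hη
      rw [Set.Finite.coe_toFinset]
      obtain ⟨h1, h2⟩ := hφne η ξ hη
      exact ⟨h1, ξ, hξ, h2⟩
  have hself : ∀ ξ0 : Euc n, ∀ k, |ξ0 k - ξ0 k| < r * Λ k ξ0 := by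
    intro ξ0 k
    simpa using mul_pos hr (hpos k ξ0)
  have hest := aux_estimate Λ hpos Φ hΦs Φ.hasCompactSupport Real.smoothTransition
    Real.smoothTransition.contDiff (K * K) (by positivity) N f (by
      intro ξ0
      obtain ⟨S, h1, h2, h3⟩ := hloc ξ0
      refine ⟨S, h1, fun η hη => (h2 η hη).2, ?_⟩
      filter_upwards [hbox r hr ξ0] with ξ hξ
      rw [show f ξ = ∑ η ∈ S, φ η ξ from finsum_eq_sum_of_support_subset _ (h3 ξ hξ)]
      refine Finset.sum_congr rfl fun η hη => ?_
      simp only [φ, if_pos (h2 η hη).1])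
  refine ⟨Real.smoothTransition ∘ f, hest.1, hest.2, ?_, ?_⟩
  · -- support
    intro ξ0 hξ0
    set τ := min r (ε / (4 * (K * K))) with hτ
    have hτ0 : 0 < τ := lt_min hr (by positivity)
    have hτr : τ ≤ r := min_le_left _ _
    have hτε : τ * (K * K) ≤ ε / 4 := by
      calc τ * (K * K) ≤ ε / (4 * (K * K)) * (K * K) := by gcongr; exact min_le_right _ _
        _ = ε / 4 := by field_simp
    obtain ⟨ξ, hξ, hne⟩ := mem_closure_iff_nhds.1 hξ0 _ (hbox τ hτ0 ξ0)
    have hξr : ∀ k, |ξ k - ξ0 k| < r * Λ k ξ0 := fun k =>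
      (hξ k).trans_le (mul_le_mul_of_nonneg_right hτr (hpos k ξ0).le)
    have hfne : f ξ ≠ 0 := by
      intro h0
      apply hne
      simp [h0]
    obtain ⟨η, hη⟩ : ∃ η, φ η ξ ≠ 0 := by
      by_contra! hall
      exact hfne (by simp [f, hall])
    obtain ⟨hηI, hηξ⟩ := hφne η ξ hη
    refine Set.mem_iUnion₂.2 ⟨η, hIX hηI, fun k => ?_⟩
    have h3 := (hcmp ξ0 ξ η hξr hηξ k).1
    have h4 := hpos k η
    calc |ξ0 k - η k| ≤ |ξ0 k - ξ k| + |ξ k - η k| := abs_sub_le _ _ _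
      _ ≤ τ * (K * K * Λ k η) + ρ * Λ k η := by
          rw [abs_sub_comm]
          exact add_le_add ((hξ k).le.trans (by gcongr)) (hηξ k)
      _ = (τ * (K * K) + ρ) * Λ k η := by ring
      _ < ε * Λ k η := by
          apply mul_lt_mul_of_pos_right _ h4
          linarith
  · -- value one
    intro ξ hξ
    obtain ⟨x, hx, hξx⟩ := Set.mem_iUnion₂.1 hξ
    have hξx' : ∀ k, |ξ k - x k| < δ * Λ k x := hξx
    have hnear : ∃ η ∈ I, ∀ k, |x k - η k| ≤ K * δ * Λ k η := by
      rcases hImax x hx with hxI | ⟨y, hy, hxy⟩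
      · refine ⟨x, hxI, fun k => ?_⟩
        have := hpos k x
        rw [sub_self, abs_zero]
        positivity
      · refine ⟨y, hy, ?_⟩
        rw [not_and_or] at hxy
        push Not at hxy
        rcases hxy with h | h
        · intro k
          have h5 := (hsw y x (fun k => (h k).le.trans
            (mul_le_mul_of_nonneg_right (by linarith) (hpos k x).le)) k).2
          rw [abs_sub_comm]
          calc |y k - x k| ≤ δ * Λ k x := (h k).le
            _ ≤ δ * (K * Λ k y) := by gcongr
            _ = _ := by ring
        · intro k
          exact (h k).le.trans (mul_le_mul_of_nonneg_right hδK (hpos k y).le)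
    obtain ⟨η, hη, hxη⟩ := hnear
    have hone : φ η ξ = 1 := by
      simp only [φ, if_pos hη]
      refine hΦ1 ξ η fun k => ?_
      have h5 := (hsw x η (fun k => (hxη k).trans
        (mul_le_mul_of_nonneg_right (by linarith) (hpos k η).le)) k).1
      calc |ξ k - η k| ≤ |ξ k - x k| + |x k - η k| := abs_sub_le _ _ _
        _ ≤ δ * (K * Λ k η) + K * δ * Λ k η :=
            add_le_add ((hξx' k).le.trans (by gcongr)) (hxη k)
        _ = 2 * (K * δ) * Λ k η := by ring
        _ = ρ / 2 * Λ k η := by rw [hKδ]; ring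
    obtain ⟨S, -, -, hS⟩ := hloc ξ
    have hfξ : 1 ≤ f ξ := by
      have hfin : (Function.support fun η => φ η ξ).Finite :=
        S.finite_toSet.subset (hS ξ (hself ξ))
      rw [← hone]
      exact single_le_finsum η hfin fun η => hφ0 η ξ
    exact Real.smoothTransition.one_of_one_le hfξ

end
end
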